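/- arXiv:1412.2637 — 7 statements merged into one kernel-verified Lean document; each statement's English description precedes it below -/
import Mathlib

section
/- Let p ∈ ℕ, let ε, μ > 0 be real constants, and let t₀ ∈ ℝ. For every pair of polynomial vector fields Ẽ, H̃ ∈ (ℝ[x₁,x₂,x₃])³ with each component of total degree at most p, there exists a unique pair (E, H) in the Trefftz space 𝕋_p (with parameters ε, μ) such that substituting t := t₀ in every component of E yields Ẽ and substituting t := t₀ in every component of H yields H̃. -/
open MvPolynomial

noncomputable section

/-- The spatial curl of a triple of polynomials in the variables `(x₁, x₂, x₃, t)`. -/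
def curl4 (F : Fin 3 → MvPolynomial (Fin 4) ℝ) : Fin 3 → MvPolynomial (Fin 4) ℝ :=
  ![pderiv 1 (F 2) - pderiv 2 (F 1),
    pderiv 2 (F 0) - pderiv 0 (F 2),
    pderiv 0 (F 1) - pderiv 1 (F 0)]

lemma curl4_add (F G : Fin 3 → MvPolynomial (Fin 4) ℝ) :
    curl4 (F + G) = curl4 F + curl4 G := by
  funext i
  fin_cases i <;> simp [curl4, map_add] <;> ring

lemma curl4_smul (c : ℝ) (F : Fin 3 → MvPolynomial (Fin 4) ℝ) :
    curl4 (c • F) = c • curl4 F := by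
  funext i
  fin_cases i <;> simp [curl4, map_smul, smul_sub]

lemma curl4_zero : curl4 0 = 0 := by
  funext i
  fin_cases i <;> simp [curl4]

/-- The Trefftz space `𝕋_p`: pairs `(E, H)` of polynomial vector fields in the
variables `(x₁, x₂, x₃, t)` of total degree at most `p` satisfying the polynomial
Maxwell equations `ε ∂ₜ E = curl H` and `μ ∂ₜ H = - curl E`. -/
def TrefftzSpace (p : ℕ) (ε μ : ℝ) :
    Submodule ℝ ((Fin 3 → MvPolynomial (Fin 4) ℝ) × (Fin 3 → MvPolynomial (Fin 4) ℝ)) where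
  carrier := { EH |
    (∀ i, (EH.1 i).totalDegree ≤ p) ∧ (∀ i, (EH.2 i).totalDegree ≤ p) ∧
    (∀ i, ε • pderiv 3 (EH.1 i) = curl4 EH.2 i) ∧
    (∀ i, μ • pderiv 3 (EH.2 i) = - curl4 EH.1 i) }
  add_mem' := by
    rintro a b ⟨ha1, ha2, ha3, ha4⟩ ⟨hb1, hb2, hb3, hb4⟩
    refine ⟨fun i => ?_, fun i => ?_, fun i => ?_, fun i => ?_⟩
    · exact (totalDegree_add _ _).trans (max_le (ha1 i) (hb1 i))
    · exact (totalDegree_add _ _).trans (max_le (ha2 i) (hb2 i))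
    · show ε • pderiv 3 (a.1 i + b.1 i) = curl4 (a.2 + b.2) i
      rw [curl4_add, map_add, smul_add, ha3 i, hb3 i, Pi.add_apply]
    · show μ • pderiv 3 (a.2 i + b.2 i) = - curl4 (a.1 + b.1) i
      rw [curl4_add, map_add, smul_add, ha4 i, hb4 i, Pi.add_apply, neg_add]
  zero_mem' := by
    refine ⟨fun i => ?_, fun i => ?_, fun i => ?_, fun i => ?_⟩ <;>
      simp [curl4_zero]
  smul_mem' := by
    rintro c a ⟨ha1, ha2, ha3, ha4⟩
    refine ⟨fun i => ?_, fun i => ?_, fun i => ?_, fun i => ?_⟩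
    · exact (totalDegree_smul_le c (a.1 i)).trans (ha1 i)
    · exact (totalDegree_smul_le c (a.2 i)).trans (ha2 i)
    · show ε • pderiv 3 (c • a.1 i) = curl4 (c • a.2) i
      rw [curl4_smul, Derivation.map_smul, smul_comm, ha3 i, Pi.smul_apply]
    · show μ • pderiv 3 (c • a.2 i) = - curl4 (c • a.1) i
      rw [curl4_smul, Derivation.map_smul, smul_comm, ha4 i, Pi.smul_apply, smul_neg]


/-- Substitution `t := t₀`: the ℝ-algebra homomorphism sending `x₁, x₂, x₃` to
themselves and the fourth variable `t` to the constant `t₀`. -/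
def substT (t₀ : ℝ) : MvPolynomial (Fin 4) ℝ →ₐ[ℝ] MvPolynomial (Fin 3) ℝ :=
  aeval ![X 0, X 1, X 2, C t₀]

/-- `DB p k q`: every monomial `m` of `q` has degree at most `p - k` (so `q = 0` if `k > p`). -/
def DB (p k : ℕ) (q : MvPolynomial (Fin 4) ℝ) : Prop :=
  ∀ m : Fin 4 →₀ ℕ, p < m.degree + k → coeff m q = 0

lemma DB_of_totalDegree {p : ℕ} {q : MvPolynomial (Fin 4) ℝ} (h : q.totalDegree ≤ p) :
    DB p 0 q := by
  intro m hm
  apply coeff_eq_zero_of_totalDegree_lt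
  have : m.degree = ∑ i ∈ m.support, m i := rfl
  omega

lemma DB.totalDegree {p k : ℕ} {q : MvPolynomial (Fin 4) ℝ} (h : DB p k q) (hq : q ≠ 0) :
    q.totalDegree + k ≤ p := by
  by_contra! hlt
  obtain ⟨m, hm, hmd⟩ : ∃ m ∈ q.support, q.totalDegree = m.degree := by
    obtain ⟨m, hm, hmd⟩ := Finset.exists_mem_eq_sup q.support
      (by simpa using hq) (fun s => s.sum fun _ e => e)
    exact ⟨m, hm, hmd⟩
  rw [mem_support_iff] at hm
  exact hm (h m (by omega))

lemma DB.sub {p k : ℕ} {q r : MvPolynomial (Fin 4) ℝ} (h : DB p k q) (h' : DB p k r) :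
    DB p k (q - r) := fun m hm => by simp [h m hm, h' m hm]

lemma DB.neg {p k : ℕ} {q : MvPolynomial (Fin 4) ℝ} (h : DB p k q) :
    DB p k (-q) := fun m hm => by simp [h m hm]

lemma DB.smul {p k : ℕ} {q : MvPolynomial (Fin 4) ℝ} (c : ℝ) (h : DB p k q) :
    DB p k (c • q) := fun m hm => by simp [h m hm]

lemma DB.pderiv {p k : ℕ} {q : MvPolynomial (Fin 4) ℝ} (j : Fin 4) (h : DB p k q) :
    DB p (k + 1) (pderiv j q) := fun m hm => by
  rw [coeff_pderiv, h _ (by simp [map_add]; omega), zero_mul]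

lemma DB.curl {p k : ℕ} {F : Fin 3 → MvPolynomial (Fin 4) ℝ} (h : ∀ i, DB p k (F i)) (i : Fin 3) :
    DB p (k + 1) (curl4 F i) := by
  fin_cases i
  · exact ((h _).pderiv _).sub ((h _).pderiv _)
  · exact ((h _).pderiv _).sub ((h _).pderiv _)
  · exact ((h _).pderiv _).sub ((h _).pderiv _)

lemma DB.eq_zero {p k : ℕ} {q : MvPolynomial (Fin 4) ℝ} (h : DB p k q) (hk : p < k) : q = 0 := by
  ext m
  simpa using h m (by omega)

lemma pderiv_swap (i j : Fin 4) (q : MvPolynomial (Fin 4) ℝ) :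
    pderiv i (pderiv j q) = pderiv j (pderiv i q) := by
  ext m
  simp only [coeff_pderiv, Finsupp.add_apply]
  by_cases hij : i = j
  · subst hij; rfl
  · rw [Finsupp.single_eq_of_ne (Ne.symm hij), Finsupp.single_eq_of_ne hij, add_right_comm]
    push_cast
    ring

lemma curl4_pderiv (F : Fin 3 → MvPolynomial (Fin 4) ℝ) (j : Fin 4) (i : Fin 3) :
    curl4 (fun i => pderiv j (F i)) i = pderiv j (curl4 F i) := by
  fin_cases i <;> simp [curl4, pderiv_swap j]

lemma substT_pderiv (t₀ : ℝ) (j : Fin 3) (q : MvPolynomial (Fin 4) ℝ) :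
    substT t₀ (pderiv j.castSucc q) = pderiv j (substT t₀ q) := by
  induction q using MvPolynomial.induction_on with
  | C a => simp [substT, ← algebraMap_eq]
  | add a b ha hb => simp [ha, hb]
  | mul_X a i ha =>
    rw [pderiv_mul, map_add, map_mul, map_mul, ha, map_mul, pderiv_mul]
    congr 2
    fin_cases i <;> fin_cases j <;> simp [substT, pderiv_X]

lemma substT_curl (t₀ : ℝ) (F : Fin 3 → MvPolynomial (Fin 4) ℝ) (h : ∀ i, substT t₀ (F i) = 0)
    (i : Fin 3) : substT t₀ (curl4 F i) = 0 := by
  have key (j : Fin 3) (l : Fin 3) : substT t₀ (pderiv j.castSucc (F l)) = 0 := by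
    rw [substT_pderiv, h, map_zero]
  have h0 := key 0
  have h1 := key 1
  have h2 := key 2
  simp only [show (0 : Fin 3).castSucc = (0 : Fin 4) from rfl] at h0
  simp only [show (1 : Fin 3).castSucc = (1 : Fin 4) from rfl] at h1
  simp only [show (2 : Fin 3).castSucc = (2 : Fin 4) from rfl] at h2
  fin_cases i <;> simp [curl4, h0, h1, h2]

lemma substT_rename (t₀ : ℝ) (q : MvPolynomial (Fin 3) ℝ) :
    substT t₀ (rename Fin.castSucc q) = q := by
  rw [substT, aeval_rename]
  conv_rhs => rw [← aeval_X_left_apply q]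
  congr 2
  funext i
  fin_cases i <;> rfl

lemma pderiv_rename_castSucc (q : MvPolynomial (Fin 3) ℝ) :
    pderiv 3 (rename Fin.castSucc q) = 0 := by
  apply pderiv_eq_zero_of_notMem_vars
  intro h
  obtain ⟨j, _, hj⟩ := mem_vars_rename _ _ h
  exact absurd hj (Fin.castSucc_lt_last j).ne

lemma eq_zero_of_pderiv_substT (t₀ : ℝ) (q : MvPolynomial (Fin 4) ℝ) (h : pderiv 3 q = 0)
    (h' : substT t₀ q = 0) : q = 0 := by
  obtain ⟨r, rfl⟩ := exists_rename_eq_of_vars_subset_range q (Fin.castSucc : Fin 3 → Fin 4)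
    (Fin.castSucc_injective 3) (by
      intro i hi
      by_cases h3 : i = 3
      · subst h3
        exfalso
        rw [Finset.mem_coe, mem_vars_iff_mem_support] at hi
        obtain ⟨d, hd, hd3⟩ := hi
        rw [mem_support_iff] at hd
        have hle : Finsupp.single 3 1 ≤ d := by
          rw [Finsupp.single_le_iff]
          exact Nat.one_le_iff_ne_zero.2 (Finsupp.mem_support_iff.1 hd3)
        have := coeff_pderiv (i := 3) q (d - Finsupp.single 3 1)
        rw [h, tsub_add_cancel_of_le hle, coeff_zero] at this
        rcases mul_eq_zero.1 this.symm with h1 | h1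
        · exact hd h1
        · exact absurd h1 (by positivity)
      · exact ⟨i.castPred h3, by simp⟩)
  rw [substT_rename] at h'
  rw [h', map_zero]

lemma trefftz_unique_aux (p : ℕ) (ε μ : ℝ) (hε : 0 < ε) (hμ : 0 < μ) (t₀ : ℝ) (n : ℕ) :
    ∀ (k : ℕ) (E H : Fin 3 → MvPolynomial (Fin 4) ℝ), p < n + k →
      (∀ i, DB p k (E i)) → (∀ i, DB p k (H i)) →
      (∀ i, ε • pderiv 3 (E i) = curl4 H i) → (∀ i, μ • pderiv 3 (H i) = - curl4 E i) →
      (∀ i, substT t₀ (E i) = 0) → (∀ i, substT t₀ (H i) = 0) →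
      (∀ i, E i = 0) ∧ (∀ i, H i = 0) := by
  induction n with
  | zero =>
    intro k E H hk hE hH _ _ _ _
    exact ⟨fun i => (hE i).eq_zero (by omega), fun i => (hH i).eq_zero (by omega)⟩
  | succ n ih =>
    intro k E H hk hE hH h1 h2 sE sH
    have := ih (k + 1) (fun i => pderiv 3 (E i)) (fun i => pderiv 3 (H i)) (by omega)
      (fun i => (hE i).pderiv 3) (fun i => (hH i).pderiv 3)
      (fun i => by rw [curl4_pderiv, ← h1, Derivation.map_smul])
      (fun i => by rw [curl4_pderiv, ← map_neg, ← h2, Derivation.map_smul])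
      (fun i => by
        have := congrArg (substT t₀) (h1 i)
        rw [map_smul, substT_curl t₀ H sH] at this
        exact (smul_eq_zero.1 this).resolve_left hε.ne')
      (fun i => by
        have := congrArg (substT t₀) (h2 i)
        rw [map_smul, map_neg, substT_curl t₀ E sE, neg_zero] at this
        exact (smul_eq_zero.1 this).resolve_left hμ.ne')
    exact ⟨fun i => eq_zero_of_pderiv_substT t₀ _ (this.1 i) (sE i),
      fun i => eq_zero_of_pderiv_substT t₀ _ (this.2 i) (sH i)⟩

/-- The Taylor weight `(t - t₀)^k / k!`. -/
def wt (t₀ : ℝ) (k : ℕ) : MvPolynomial (Fin 4) ℝ :=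
  C ((k.factorial : ℝ)⁻¹) * (X 3 - C t₀) ^ k

lemma wt_pderiv_ne (t₀ : ℝ) (k : ℕ) (j : Fin 4) (hj : j ≠ 3) : pderiv j (wt t₀ k) = 0 := by
  rw [wt, pderiv_C_mul, pderiv_pow, map_sub, pderiv_X_of_ne hj.symm, pderiv_C]
  simp

lemma wt_pderiv_zero (t₀ : ℝ) : pderiv 3 (wt t₀ 0) = 0 := by
  simp [wt]

lemma wt_pderiv_succ (t₀ : ℝ) (k : ℕ) : pderiv 3 (wt t₀ (k + 1)) = wt t₀ k := by
  rw [wt, pderiv_C_mul, pderiv_pow, map_sub, pderiv_X_self, pderiv_C, wt]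
  have : ((k : MvPolynomial (Fin 4) ℝ) + 1) = C ((k : ℝ) + 1) := by simp
  push_cast
  rw [this, sub_zero, mul_one, ← mul_assoc, ← C_mul]
  congr 2
  have h1 : (k.factorial : ℝ) ≠ 0 := by positivity
  have h2 : (k : ℝ) + 1 ≠ 0 := by positivity
  rw [Nat.factorial_succ]
  push_cast
  field_simp

lemma substT_wt_zero (t₀ : ℝ) : substT t₀ (wt t₀ 0) = 1 := by
  simp [wt]

lemma substT_wt_succ (t₀ : ℝ) (k : ℕ) : substT t₀ (wt t₀ (k + 1)) = 0 := by
  simp [wt, substT, ← algebraMap_eq]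

lemma wt_totalDegree (t₀ : ℝ) (k : ℕ) : (wt t₀ k).totalDegree ≤ k := by
  refine (totalDegree_mul _ _).trans ?_
  rw [totalDegree_C, zero_add]
  refine (totalDegree_pow _ _).trans ?_
  have : (X 3 - C t₀ : MvPolynomial (Fin 4) ℝ).totalDegree ≤ 1 :=
    (totalDegree_sub _ _).trans (by simp)
  nlinarith

/-- Taylor sum. -/
def tay (p : ℕ) (t₀ : ℝ) (f : ℕ → Fin 3 → MvPolynomial (Fin 4) ℝ) (i : Fin 3) :
    MvPolynomial (Fin 4) ℝ := ∑ k ∈ Finset.range (p + 1), wt t₀ k * f k i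

lemma tay_totalDegree (p : ℕ) (t₀ : ℝ) (f : ℕ → Fin 3 → MvPolynomial (Fin 4) ℝ)
    (hf : ∀ k i, DB p k (f k i)) (i : Fin 3) : (tay p t₀ f i).totalDegree ≤ p := by
  apply totalDegree_finsetSum_le
  intro k _
  by_cases h0 : f k i = 0
  · simp [h0]
  · have h1 := (hf k i).totalDegree h0
    have h2 := wt_totalDegree t₀ k
    exact (totalDegree_mul _ _).trans (by omega)

lemma tay_substT (p : ℕ) (t₀ : ℝ) (f : ℕ → Fin 3 → MvPolynomial (Fin 4) ℝ) (i : Fin 3) :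
    substT t₀ (tay p t₀ f i) = substT t₀ (f 0 i) := by
  rw [tay, Finset.sum_range_succ', map_add, map_sum, Finset.sum_eq_zero, map_mul,
    substT_wt_zero, one_mul, zero_add]
  intro k _
  rw [map_mul, substT_wt_succ, zero_mul]

lemma tay_pderiv (p : ℕ) (t₀ : ℝ) (f : ℕ → Fin 3 → MvPolynomial (Fin 4) ℝ)
    (hf : ∀ k i, DB p k (f k i)) (ht : ∀ k i, pderiv 3 (f k i) = 0) (i : Fin 3) :
    pderiv 3 (tay p t₀ f i) = ∑ k ∈ Finset.range (p + 1), wt t₀ k * f (k + 1) i := by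
  rw [tay, Finset.sum_range_succ', Finset.sum_range_succ,
    (hf (p + 1) i).eq_zero (Nat.lt_succ_self p), map_add, map_sum, pderiv_mul, ht, wt_pderiv_zero]
  simp only [pderiv_mul, ht, wt_pderiv_succ, mul_zero, add_zero, zero_mul]

lemma tay_pderiv_ne (p : ℕ) (t₀ : ℝ) (f : ℕ → Fin 3 → MvPolynomial (Fin 4) ℝ) (i : Fin 3)
    (j : Fin 4) (hj : j ≠ 3) :
    pderiv j (tay p t₀ f i) = ∑ k ∈ Finset.range (p + 1), wt t₀ k * pderiv j (f k i) := by
  simp only [tay, map_sum, pderiv_mul, wt_pderiv_ne t₀ _ j hj, zero_mul, zero_add]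

lemma tay_curl (p : ℕ) (t₀ : ℝ) (f : ℕ → Fin 3 → MvPolynomial (Fin 4) ℝ) (i : Fin 3) :
    curl4 (tay p t₀ f) i = ∑ k ∈ Finset.range (p + 1), wt t₀ k * curl4 (f k) i := by
  have h0 := fun i => tay_pderiv_ne p t₀ f i 0 (by decide)
  have h1 := fun i => tay_pderiv_ne p t₀ f i 1 (by decide)
  have h2 := fun i => tay_pderiv_ne p t₀ f i 2 (by decide)
  fin_cases i <;> simp [curl4, h0, h1, h2, mul_sub]

/-- Iterates of the spatial Maxwell operator on the initial data. -/
def mseq (ε μ : ℝ) (E H : Fin 3 → MvPolynomial (Fin 4) ℝ) :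
    ℕ → (Fin 3 → MvPolynomial (Fin 4) ℝ) × (Fin 3 → MvPolynomial (Fin 4) ℝ)
  | 0 => (E, H)
  | k + 1 => (fun i => ε⁻¹ • curl4 (mseq ε μ E H k).2 i,
      fun i => μ⁻¹ • (- curl4 (mseq ε μ E H k).1 i))

lemma mseq_DB (p : ℕ) (ε μ : ℝ) (E H : Fin 3 → MvPolynomial (Fin 4) ℝ)
    (hE : ∀ i, DB p 0 (E i)) (hH : ∀ i, DB p 0 (H i)) (k : ℕ) :
    (∀ i, DB p k ((mseq ε μ E H k).1 i)) ∧ (∀ i, DB p k ((mseq ε μ E H k).2 i)) := by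
  induction k with
  | zero => exact ⟨hE, hH⟩
  | succ k ih =>
    exact ⟨fun i => (DB.curl ih.2 i).smul _, fun i => (DB.curl ih.1 i).neg.smul _⟩

lemma curl4_pderiv_zero {F : Fin 3 → MvPolynomial (Fin 4) ℝ} (h : ∀ i, pderiv 3 (F i) = 0)
    (i : Fin 3) : pderiv 3 (curl4 F i) = 0 := by
  rw [← curl4_pderiv]
  simp only [h]
  exact congrFun curl4_zero i

lemma mseq_pderiv (ε μ : ℝ) (E H : Fin 3 → MvPolynomial (Fin 4) ℝ)
    (hE : ∀ i, pderiv 3 (E i) = 0) (hH : ∀ i, pderiv 3 (H i) = 0) (k : ℕ) :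
    (∀ i, pderiv 3 ((mseq ε μ E H k).1 i) = 0) ∧ (∀ i, pderiv 3 ((mseq ε μ E H k).2 i) = 0) := by
  induction k with
  | zero => exact ⟨hE, hH⟩
  | succ k ih =>
    refine ⟨fun i => ?_, fun i => ?_⟩
    · rw [mseq, Derivation.map_smul, curl4_pderiv_zero ih.2, smul_zero]
    · rw [mseq, Derivation.map_smul, map_neg, curl4_pderiv_zero ih.1, neg_zero, smul_zero]

/-- For every pair of polynomial vector fields `Ẽ, H̃` of total degree at most `p`
there is a unique pair `(E, H)` in the Trefftz space `𝕋_p` whose fields at time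
`t = t₀` are `Ẽ` and `H̃`. -/
theorem trefftz_exists_unique_initial_data (p : ℕ) (ε μ : ℝ) (hε : 0 < ε) (hμ : 0 < μ)
    (t₀ : ℝ) (Etil Htil : Fin 3 → MvPolynomial (Fin 3) ℝ)
    (hEtil : ∀ i, (Etil i).totalDegree ≤ p) (hHtil : ∀ i, (Htil i).totalDegree ≤ p) :
    ∃! EH : (Fin 3 → MvPolynomial (Fin 4) ℝ) × (Fin 3 → MvPolynomial (Fin 4) ℝ),
      EH ∈ TrefftzSpace p ε μ ∧
      (∀ i, substT t₀ (EH.1 i) = Etil i) ∧ (∀ i, substT t₀ (EH.2 i) = Htil i) := by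
  set E0 : Fin 3 → MvPolynomial (Fin 4) ℝ := fun i => rename Fin.castSucc (Etil i) with hE0
  set H0 : Fin 3 → MvPolynomial (Fin 4) ℝ := fun i => rename Fin.castSucc (Htil i) with hH0
  have dE : ∀ i, DB p 0 (E0 i) := fun i =>
    DB_of_totalDegree ((totalDegree_rename_le _ _).trans (hEtil i))
  have dH : ∀ i, DB p 0 (H0 i) := fun i =>
    DB_of_totalDegree ((totalDegree_rename_le _ _).trans (hHtil i))
  have hD := mseq_DB p ε μ E0 H0 dE dH
  have hP := mseq_pderiv ε μ E0 H0 (fun i => pderiv_rename_castSucc _)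
    (fun i => pderiv_rename_castSucc _)
  have huniq : ∀ A B : (Fin 3 → MvPolynomial (Fin 4) ℝ) × (Fin 3 → MvPolynomial (Fin 4) ℝ),
      (A ∈ TrefftzSpace p ε μ ∧
        (∀ i, substT t₀ (A.1 i) = Etil i) ∧ (∀ i, substT t₀ (A.2 i) = Htil i)) →
      (B ∈ TrefftzSpace p ε μ ∧
        (∀ i, substT t₀ (B.1 i) = Etil i) ∧ (∀ i, substT t₀ (B.2 i) = Htil i)) → A = B := by
    rintro A B ⟨hA, hA1, hA2⟩ ⟨hB, hB1, hB2⟩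
    obtain ⟨d1, d2, d3, d4⟩ := (TrefftzSpace p ε μ).sub_mem hA hB
    obtain ⟨z1, z2⟩ := trefftz_unique_aux p ε μ hε hμ t₀ (p + 1) 0 (A - B).1 (A - B).2 (by omega)
      (fun i => DB_of_totalDegree (d1 i)) (fun i => DB_of_totalDegree (d2 i)) d3 d4
      (fun i => by simp [hA1, hB1]) (fun i => by simp [hA2, hB2])
    exact sub_eq_zero.1 (Prod.ext (funext z1) (funext z2))
  refine existsUnique_of_exists_of_unique ⟨(tay p t₀ (fun k => (mseq ε μ E0 H0 k).1), tay p t₀ (fun k => (mseq ε μ E0 H0 k).2)),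
    ⟨?_, ?_, ?_, ?_⟩, ?_, ?_⟩ huniq
  · exact tay_totalDegree p t₀ _ (fun k => (hD k).1)
  · exact tay_totalDegree p t₀ _ (fun k => (hD k).2)
  · intro i
    rw [tay_curl, tay_pderiv p t₀ _ (fun k => (hD k).1) (fun k => (hP k).1), Finset.smul_sum]
    refine Finset.sum_congr rfl fun k _ => ?_
    rw [mseq, mul_smul_comm, smul_inv_smul₀ hε.ne']
  · intro i
    rw [tay_curl, tay_pderiv p t₀ _ (fun k => (hD k).2) (fun k => (hP k).2), Finset.smul_sum,
      ← Finset.sum_neg_distrib]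
    refine Finset.sum_congr rfl fun k _ => ?_
    rw [mseq, mul_smul_comm, smul_inv_smul₀ hμ.ne', mul_neg]
  · intro i
    rw [tay_substT]
    exact substT_rename t₀ (Etil i)
  · intro i
    rw [tay_substT]
    exact substT_rename t₀ (Htil i)

end
end

section
/- Let p ∈ ℕ and let ε, μ > 0 be real constants. The Trefftz space 𝕋_p is a finite-dimensional real vector space and its dimension equals (p+1)(p+2)(p+3). -/
open MvPolynomial

noncomputable section

abbrev PolyFields := (Fin 3 → MvPolynomial (Fin 4) ℝ) × (Fin 3 → MvPolynomial (Fin 4) ℝ)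

/-- The space operator of the Maxwell system in the form `∂ₜ u = A u`. -/
def maxwellOp (ε μ : ℝ) : PolyFields →ₗ[ℝ] PolyFields where
  toFun u := (ε⁻¹ • curl4 u.2, (-μ⁻¹) • curl4 u.1)
  map_add' u v := by simp [curl4_add, smul_add, add_comm]
  map_smul' c u := by
    simp only [Prod.smul_snd, Prod.smul_fst, curl4_smul, RingHom.id_apply, Prod.smul_mk]
    rw [smul_comm, smul_comm (-μ⁻¹)]

/-- The time derivative. -/
def timeDeriv : PolyFields →ₗ[ℝ] PolyFields where
  toFun u := (fun i => pderiv 3 (u.1 i), fun i => pderiv 3 (u.2 i))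
  map_add' u v := by ext <;> simp
  map_smul' c u := by ext <;> simp

/-- All coefficients of degree at least `d` vanish. -/
def DegLT (d : ℕ) (u : PolyFields) : Prop :=
  ∀ m : Fin 4 →₀ ℕ, d ≤ m.degree → ∀ i, coeff m (u.1 i) = 0 ∧ coeff m (u.2 i) = 0

lemma totalDegree_le_iff_coeff (f : MvPolynomial (Fin 4) ℝ) (p : ℕ) :
    f.totalDegree ≤ p ↔ ∀ m : Fin 4 →₀ ℕ, p + 1 ≤ m.degree → coeff m f = 0 := by
  constructor
  · intro h m hm
    apply coeff_eq_zero_of_totalDegree_lt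
    have : m.degree = ∑ i ∈ m.support, m i := rfl
    omega
  · intro h
    refine Finset.sup_le fun m hm => ?_
    by_contra hlt
    refine (mem_support_iff.mp hm) (h m ?_)
    have : m.degree = m.sum fun _ e => e := rfl
    omega

lemma degLT_iff (u : PolyFields) (p : ℕ) :
    DegLT (p + 1) u ↔ (∀ i, (u.1 i).totalDegree ≤ p) ∧ ∀ i, (u.2 i).totalDegree ≤ p := by
  simp only [totalDegree_le_iff_coeff, DegLT]
  constructor
  · intro h
    exact ⟨fun i m hm => (h m hm i).1, fun i m hm => (h m hm i).2⟩
  · intro h m hm i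
    exact ⟨h.1 i m hm, h.2 i m hm⟩

lemma coeff_curl4_eq_zero (F : Fin 3 → MvPolynomial (Fin 4) ℝ) (m : Fin 4 →₀ ℕ)
    (h : ∀ j : Fin 4, j ≠ 3 → ∀ i, coeff (m + Finsupp.single j 1) (F i) = 0) (i : Fin 3) :
    coeff m (curl4 F i) = 0 := by
  have h0 := h 0 (by decide)
  have h1 := h 1 (by decide)
  have h2 := h 2 (by decide)
  fin_cases i <;> simp [curl4, coeff_pderiv, h0, h1, h2]

lemma DegLT.maxwellOp {d : ℕ} {u : PolyFields} (h : DegLT d u) (ε μ : ℝ) :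
    DegLT (d - 1) (maxwellOp ε μ u) := by
  intro m hm i
  have hd : ∀ j : Fin 4, d ≤ (m + Finsupp.single j 1).degree := by
    intro j
    rw [map_add, Finsupp.degree_single]
    omega
  have h1 := coeff_curl4_eq_zero u.1 m (fun j _ i => (h _ (hd j) i).1) i
  have h2 := coeff_curl4_eq_zero u.2 m (fun j _ i => (h _ (hd j) i).2) i
  simp [_root_.maxwellOp, h1, h2]

lemma DegLT.maxwellOp_pow {d : ℕ} {u : PolyFields} (h : DegLT d u) (ε μ : ℝ) (k : ℕ) :
    DegLT (d - k) ((_root_.maxwellOp ε μ ^ k) u) := by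
  induction k with
  | zero => simpa using h
  | succ k ih =>
    rw [pow_succ', Module.End.mul_apply]
    exact ih.maxwellOp ε μ

lemma DegLT.eq_zero {u : PolyFields} (h : DegLT 0 u) : u = 0 := by
  ext i m
  · simpa using (h m (Nat.zero_le _) i).1
  · simpa using (h m (Nat.zero_le _) i).2

lemma pderiv_three_comm (j : Fin 4) (hj : j ≠ 3) (f : MvPolynomial (Fin 4) ℝ) :
    pderiv 3 (pderiv j f) = pderiv j (pderiv 3 f) := by
  ext m
  simp only [coeff_pderiv, Finsupp.add_apply, Finsupp.single_apply]
  rw [add_right_comm, if_neg hj, if_neg hj.symm]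
  push_cast
  ring

lemma timeDeriv_maxwellOp (ε μ : ℝ) (u : PolyFields) :
    timeDeriv (maxwellOp ε μ u) = maxwellOp ε μ (timeDeriv u) := by
  have key : ∀ F : Fin 3 → MvPolynomial (Fin 4) ℝ,
      ∀ i, pderiv 3 (curl4 F i) = curl4 (fun i => pderiv 3 (F i)) i := by
    intro F i
    fin_cases i <;>
      simp [curl4, pderiv_three_comm]
  ext1
  · funext i
    simp [timeDeriv, maxwellOp, key]
  · funext i
    simp [timeDeriv, maxwellOp, key]

lemma timeDeriv_pow_eq_zero (ε μ : ℝ) (u : PolyFields) (hu : timeDeriv u = 0) (k : ℕ) :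
    timeDeriv ((maxwellOp ε μ ^ k) u) = 0 := by
  induction k with
  | zero => simpa using hu
  | succ k ih =>
    rw [pow_succ', Module.End.mul_apply, timeDeriv_maxwellOp, ih, map_zero]

lemma maxwellOp_X_pow (ε μ : ℝ) (k : ℕ) (u : PolyFields) :
    maxwellOp ε μ ((X 3 : MvPolynomial (Fin 4) ℝ) ^ k • u) =
      (X 3 : MvPolynomial (Fin 4) ℝ) ^ k • maxwellOp ε μ u := by
  have key : ∀ F : Fin 3 → MvPolynomial (Fin 4) ℝ,
      curl4 ((X 3 : MvPolynomial (Fin 4) ℝ) ^ k • F) =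
        (X 3 : MvPolynomial (Fin 4) ℝ) ^ k • curl4 F := by
    intro F
    have hX : ∀ j : Fin 4, j ≠ 3 → ∀ f : MvPolynomial (Fin 4) ℝ,
        pderiv j ((X 3 : MvPolynomial (Fin 4) ℝ) ^ k * f) = X 3 ^ k * pderiv j f := by
      intro j hj f
      rw [pderiv_mul, pderiv_pow, pderiv_X_of_ne hj.symm]
      ring
    funext i
    fin_cases i <;> simp [curl4, hX, mul_sub, -Derivation.leibniz]
  simp only [maxwellOp, LinearMap.coe_mk, AddHom.coe_mk, Prod.smul_fst, Prod.smul_snd, key,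
    Prod.smul_mk]
  rw [smul_comm, smul_comm (-μ⁻¹)]

lemma timeDeriv_X_pow (k : ℕ) (u : PolyFields) (hu : timeDeriv u = 0) :
    timeDeriv ((X 3 : MvPolynomial (Fin 4) ℝ) ^ (k + 1) • u) =
      ((k : ℝ) + 1) • (X 3 : MvPolynomial (Fin 4) ℝ) ^ k • u := by
  have h1 : ∀ i, pderiv 3 (u.1 i) = 0 := fun i => congrFun (congrArg Prod.fst hu) i
  have h2 : ∀ i, pderiv 3 (u.2 i) = 0 := fun i => congrFun (congrArg Prod.snd hu) i
  have key : ∀ f : MvPolynomial (Fin 4) ℝ, pderiv 3 f = 0 →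
      pderiv 3 ((X 3 : MvPolynomial (Fin 4) ℝ) ^ (k + 1) * f) =
        ((k : ℝ) + 1) • (X 3 ^ k * f) := by
    intro f hf
    rw [pderiv_mul, pderiv_pow, pderiv_X_self, hf, smul_eq_C_mul]
    simp
    ring
  ext1
  · funext i
    exact key _ (h1 i)
  · funext i
    exact key _ (h2 i)

lemma mem_trefftz_iff (p : ℕ) (ε μ : ℝ) (hε : 0 < ε) (hμ : 0 < μ) (u : PolyFields) :
    u ∈ TrefftzSpace p ε μ ↔ DegLT (p + 1) u ∧ timeDeriv u = maxwellOp ε μ u := by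
  rw [degLT_iff]
  change (_ ∧ _ ∧ _ ∧ _) ↔ _
  rw [← and_assoc]
  refine and_congr_right fun _ => ?_
  simp only [timeDeriv, maxwellOp, LinearMap.coe_mk, AddHom.coe_mk, Prod.mk.injEq, funext_iff,
    Pi.smul_apply]
  refine and_congr (forall_congr' fun i => ?_) (forall_congr' fun i => ?_)
  · rw [eq_inv_smul_iff₀ hε.ne']
  · rw [neg_smul, ← smul_neg, eq_inv_smul_iff₀ hμ.ne']

/-- The Taylor solution of the initial value problem. -/
def taylorSol (p : ℕ) (ε μ : ℝ) (u : PolyFields) : PolyFields :=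
  ∑ k ∈ Finset.range (p + 1), ((k.factorial : ℝ)⁻¹) •
    (X 3 : MvPolynomial (Fin 4) ℝ) ^ k • (maxwellOp ε μ ^ k) u

lemma taylorSol_eq (p : ℕ) (ε μ : ℝ) (u : PolyFields) (hd : DegLT (p + 1) u)
    (hu : timeDeriv u = 0) :
    timeDeriv (taylorSol p ε μ u) = maxwellOp ε μ (taylorSol p ε μ u) := by
  have hz : (maxwellOp ε μ ^ (p + 1)) u = 0 := by
    have := hd.maxwellOp_pow ε μ (p + 1)
    rw [Nat.sub_self] at this
    exact this.eq_zero
  rw [taylorSol, map_sum, map_sum, Finset.sum_range_succ', Finset.sum_range_succ]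
  congr 1
  · refine Finset.sum_congr rfl fun k _ => ?_
    rw [LinearMap.map_smul timeDeriv (_ : ℝ), LinearMap.map_smul (maxwellOp ε μ) (_ : ℝ), timeDeriv_X_pow _ _ (timeDeriv_pow_eq_zero ε μ u hu _),
      maxwellOp_X_pow, smul_smul, pow_succ', Module.End.mul_apply]
    congr 1
    rw [Nat.factorial_succ]
    have : (k.factorial : ℝ) ≠ 0 := by positivity
    have : (k : ℝ) + 1 ≠ 0 := by positivity
    push_cast
    field_simp
  · rw [LinearMap.map_smul timeDeriv (_ : ℝ), LinearMap.map_smul (maxwellOp ε μ) (_ : ℝ), maxwellOp_X_pow, ← Module.End.mul_apply, ← pow_succ', hz]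
    simp [hu]

lemma taylorSol_degLT (p : ℕ) (ε μ : ℝ) (u : PolyFields) (hd : DegLT (p + 1) u) :
    DegLT (p + 1) (taylorSol p ε μ u) := by
  have key : ∀ k ∈ Finset.range (p + 1), DegLT (p + 1) (((k.factorial : ℝ)⁻¹) •
    (X 3 : MvPolynomial (Fin 4) ℝ) ^ k • (maxwellOp ε μ ^ k) u) := by
    intro k hk
    rw [Finset.mem_range] at hk
    have h := hd.maxwellOp_pow ε μ k
    rw [show p + 1 - k = (p - k) + 1 by omega, degLT_iff] at h
    rw [degLT_iff]
    have hX : ∀ f : MvPolynomial (Fin 4) ℝ, f.totalDegree ≤ p - k →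
        (((k.factorial : ℝ)⁻¹) • ((X 3 : MvPolynomial (Fin 4) ℝ) ^ k * f)).totalDegree ≤ p := by
      intro f hf
      refine (totalDegree_smul_le _ _).trans ((totalDegree_mul _ _).trans ?_)
      rw [totalDegree_X_pow]
      omega
    exact ⟨fun i => hX _ (h.1 i), fun i => hX _ (h.2 i)⟩
  rw [degLT_iff]
  simp only [degLT_iff] at key
  constructor
  · intro i
    rw [taylorSol, Prod.fst_sum, Finset.sum_apply]
    exact totalDegree_finsetSum_le fun k hk => (key k hk).1 i
  · intro i
    rw [taylorSol, Prod.snd_sum, Finset.sum_apply]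
    exact totalDegree_finsetSum_le fun k hk => (key k hk).2 i

lemma taylorSol_coeff (p : ℕ) (ε μ : ℝ) (u : PolyFields) (m : Fin 4 →₀ ℕ) (hm : m 3 = 0)
    (i : Fin 3) : coeff m ((taylorSol p ε μ u).1 i) = coeff m (u.1 i) ∧
      coeff m ((taylorSol p ε μ u).2 i) = coeff m (u.2 i) := by
  have hX : ∀ k (f : MvPolynomial (Fin 4) ℝ),
      coeff m ((X 3 : MvPolynomial (Fin 4) ℝ) ^ (k + 1) * f) = 0 := by
    intro k f
    rw [pow_succ', mul_assoc, coeff_X_mul', if_neg]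
    simpa using hm
  rw [taylorSol, Finset.sum_range_succ']
  constructor
  · simp [Prod.fst_sum, Finset.sum_apply, coeff_sum, hX]
  · simp [Prod.snd_sum, Finset.sum_apply, coeff_sum, hX]

/-- Solutions with vanishing initial data vanish. -/
lemma eq_zero_of_initial (ε μ : ℝ) (u : PolyFields)
    (h : timeDeriv u = maxwellOp ε μ u)
    (h0 : ∀ m : Fin 4 →₀ ℕ, m 3 = 0 → ∀ i, coeff m (u.1 i) = 0 ∧ coeff m (u.2 i) = 0) :
    u = 0 := by
  have key : ∀ n : ℕ, ∀ m : Fin 4 →₀ ℕ, m 3 = n →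
      ∀ i, coeff m (u.1 i) = 0 ∧ coeff m (u.2 i) = 0 := by
    intro n
    induction n with
    | zero => exact h0
    | succ n ih =>
      intro m hm i
      obtain ⟨m', rfl⟩ : ∃ m', m = m' + Finsupp.single 3 1 :=
        ⟨m - Finsupp.single 3 1, (Finsupp.sub_add_single_one_cancel (by omega)).symm⟩
      have hm' : m' 3 = n := by simpa using hm
      have hj : ∀ j : Fin 4, j ≠ 3 → (m' + Finsupp.single j 1 : Fin 4 →₀ ℕ) 3 = n := by
        intro j hj
        simp [hm', hj]
      have c1 := coeff_curl4_eq_zero u.1 m' (fun j hne i => (ih _ (hj j hne) i).1) i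
      have c2 := coeff_curl4_eq_zero u.2 m' (fun j hne i => (ih _ (hj j hne) i).2) i
      have e1 : pderiv 3 (u.1 i) = ε⁻¹ • curl4 u.2 i := congrFun (congrArg Prod.fst h) i
      have e2 : pderiv 3 (u.2 i) = (-μ⁻¹) • curl4 u.1 i := congrFun (congrArg Prod.snd h) i
      have f1 := congrArg (coeff m') e1
      have f2 := congrArg (coeff m') e2
      rw [coeff_pderiv, coeff_smul, c2, smul_zero] at f1
      rw [coeff_pderiv, coeff_smul, c1, smul_zero] at f2
      have hne : ((m' 3 : ℝ) + 1) ≠ 0 := by positivity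
      exact ⟨(mul_eq_zero.mp f1).resolve_right hne, (mul_eq_zero.mp f2).resolve_right hne⟩
  ext i m
  · simpa using (key _ m rfl i).1
  · simpa using (key _ m rfl i).2

/-- Index set: exponents of total mass `p`; the last entry is slack. -/
abbrev ExpIdx (p : ℕ) := {P : Fin 4 → ℕ // ∑ i, P i = p}

/-- The time independent exponent associated with an index. -/
def expOf {p : ℕ} (q : ExpIdx p) : Fin 4 →₀ ℕ :=
  Finsupp.equivFunOnFinite.symm ![q.1 0, q.1 1, q.1 2, 0]

lemma expOf_three {p : ℕ} (q : ExpIdx p) : expOf q 3 = 0 := rfl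

lemma degree_four (m : Fin 4 →₀ ℕ) : m.degree = m 0 + m 1 + m 2 + m 3 := by
  rw [Finsupp.degree_eq_sum, Fin.sum_univ_four]

lemma expOf_degree {p : ℕ} (q : ExpIdx p) : (expOf q).degree ≤ p := by
  have h := q.2
  rw [Fin.sum_univ_four] at h
  have : (expOf q).degree = q.1 0 + q.1 1 + q.1 2 + 0 := degree_four _
  omega

lemma expOf_injective {p : ℕ} : Function.Injective (expOf (p := p)) := by
  intro q r h
  have h0 : q.1 0 = r.1 0 := DFunLike.congr_fun h 0
  have h1 : q.1 1 = r.1 1 := DFunLike.congr_fun h 1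
  have h2 : q.1 2 = r.1 2 := DFunLike.congr_fun h 2
  have hq := q.2
  have hr := r.2
  rw [Fin.sum_univ_four] at hq hr
  apply Subtype.ext
  funext i
  fin_cases i
  · exact h0
  · exact h1
  · exact h2
  · change q.1 3 = r.1 3
    omega

lemma exists_expOf {p : ℕ} (m : Fin 4 →₀ ℕ) (h3 : m 3 = 0) (hd : m.degree ≤ p) :
    ∃ q : ExpIdx p, expOf q = m := by
  refine ⟨⟨![m 0, m 1, m 2, p - m.degree], ?_⟩, ?_⟩
  · rw [Fin.sum_univ_four]
    have := degree_four m
    change m 0 + m 1 + m 2 + (p - m.degree) = p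
    omega
  · ext i
    fin_cases i
    · rfl
    · rfl
    · rfl
    · exact h3.symm

instance expIdxFintype (p : ℕ) : Fintype (ExpIdx p) :=
  Fintype.ofEquiv _ (Sym.equivNatSumOfFintype (Fin 4) p)

lemma card_expIdx (p : ℕ) : 6 * Fintype.card (ExpIdx p) = (p + 1) * (p + 2) * (p + 3) := by
  rw [← Fintype.card_congr (Sym.equivNatSumOfFintype (Fin 4) p), Sym.card_sym_eq_choose,
    Fintype.card_fin, show 4 + p - 1 = p + 3 by omega, ← Nat.choose_symm_of_eq_add (show p + 3 = 3 + p by omega)]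
  have h := Nat.descFactorial_eq_factorial_mul_choose (p + 3) 3
  have h6 : Nat.factorial 3 = 6 := rfl
  rw [h6] at h
  rw [← h]
  simp [Nat.descFactorial]
  ring

/-- The initial data of a field. -/
def initialData (p : ℕ) : PolyFields →ₗ[ℝ]
    (Fin 3 × ExpIdx p → ℝ) × (Fin 3 × ExpIdx p → ℝ) where
  toFun u := (fun x => coeff (expOf x.2) (u.1 x.1), fun x => coeff (expOf x.2) (u.2 x.1))
  map_add' u v := by ext <;> simp
  map_smul' c u := by ext <;> simp

/-- The field with given initial data. -/
def ofInitial (p : ℕ) (a : Fin 3 × ExpIdx p → ℝ) (i : Fin 3) : MvPolynomial (Fin 4) ℝ :=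
  ∑ q : ExpIdx p, monomial (expOf q) (a (i, q))

lemma coeff_ofInitial (p : ℕ) (a : Fin 3 × ExpIdx p → ℝ) (i : Fin 3) (q : ExpIdx p) :
    coeff (expOf q) (ofInitial p a i) = a (i, q) := by
  classical
  simp [ofInitial, coeff_sum, coeff_monomial, expOf_injective.eq_iff]

lemma coeff_ofInitial_of_lt (p : ℕ) (a : Fin 3 × ExpIdx p → ℝ) (i : Fin 3) (m : Fin 4 →₀ ℕ)
    (hm : p + 1 ≤ m.degree) : coeff m (ofInitial p a i) = 0 := by
  classical
  rw [ofInitial, coeff_sum]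
  refine Finset.sum_eq_zero fun q _ => ?_
  rw [coeff_monomial, if_neg]
  rintro rfl
  have := expOf_degree q
  omega

lemma pderiv_ofInitial (p : ℕ) (a : Fin 3 × ExpIdx p → ℝ) (i : Fin 3) :
    pderiv 3 (ofInitial p a i) = 0 := by
  rw [ofInitial, map_sum]
  refine Finset.sum_eq_zero fun q _ => ?_
  rw [pderiv_monomial, expOf_three]
  simp

lemma initialData_bijective (p : ℕ) (ε μ : ℝ) (hε : 0 < ε) (hμ : 0 < μ) :
    Function.Bijective ((initialData p).comp (TrefftzSpace p ε μ).subtype) := by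
  constructor
  · rw [injective_iff_map_eq_zero]
    rintro ⟨u, hu⟩ h
    obtain ⟨hd, he⟩ := (mem_trefftz_iff p ε μ hε hμ u).mp hu
    apply Subtype.ext
    refine eq_zero_of_initial ε μ u he fun m hm i => ?_
    by_cases hdeg : p + 1 ≤ m.degree
    · exact hd m hdeg i
    · obtain ⟨q, rfl⟩ := exists_expOf (p := p) m hm (by omega)
      exact ⟨congrFun (congrArg Prod.fst h) (i, q), congrFun (congrArg Prod.snd h) (i, q)⟩
  · rintro ⟨a, b⟩
    let u : PolyFields := (ofInitial p a, ofInitial p b)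
    have hd : DegLT (p + 1) u := fun m hm i =>
      ⟨coeff_ofInitial_of_lt p a i m hm, coeff_ofInitial_of_lt p b i m hm⟩
    have hu : timeDeriv u = 0 := by
      ext1
      · funext i
        exact pderiv_ofInitial p a i
      · funext i
        exact pderiv_ofInitial p b i
    refine ⟨⟨taylorSol p ε μ u, (mem_trefftz_iff p ε μ hε hμ _).mpr
      ⟨taylorSol_degLT p ε μ u hd, taylorSol_eq p ε μ u hd hu⟩⟩, ?_⟩
    ext1
    · funext x
      exact (taylorSol_coeff p ε μ u _ (expOf_three x.2) x.1).1.trans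
        (coeff_ofInitial p a x.1 x.2)
    · funext x
      exact (taylorSol_coeff p ε μ u _ (expOf_three x.2) x.1).2.trans
        (coeff_ofInitial p b x.1 x.2)

/-- The Trefftz space `𝕋_p` is finite dimensional of dimension `(p+1)(p+2)(p+3)`. -/
theorem trefftz_finrank (p : ℕ) (ε μ : ℝ) (hε : 0 < ε) (hμ : 0 < μ) :
    FiniteDimensional ℝ (TrefftzSpace p ε μ) ∧
      Module.finrank ℝ (TrefftzSpace p ε μ) = (p + 1) * (p + 2) * (p + 3) := by
  have e := LinearEquiv.ofBijective _ (initialData_bijective p ε μ hε hμ)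
  refine ⟨Module.Finite.equiv e.symm, ?_⟩
  rw [e.finrank_eq, Module.finrank_prod, Module.finrank_fintype_fun_eq_card, Fintype.card_prod,
    Fintype.card_fin, ← card_expIdx]
  ring

end
end

section
/- Let p ∈ ℕ and let ε, μ > 0 be real constants. The divergence-free Trefftz space 𝕋̃_p = {(E, H) ∈ 𝕋_p : div E = 0 and div H = 0} is a finite-dimensional real vector space whose dimension d satisfies 3·d = (p+1)(p+2)(2p+9). -/
open MvPolynomial

noncomputable section

/-- The spatial divergence of a triple of polynomials in the variables `(x₁, x₂, x₃, t)`. -/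
def div4 (F : Fin 3 → MvPolynomial (Fin 4) ℝ) : MvPolynomial (Fin 4) ℝ :=
  pderiv 0 (F 0) + pderiv 1 (F 1) + pderiv 2 (F 2)

/-- The divergence-free Trefftz space `𝕋̃_p = {(E,H) ∈ 𝕋_p : div E = 0, div H = 0}`. -/
def TrefftzDivFree (p : ℕ) (ε μ : ℝ) :
    Submodule ℝ ((Fin 3 → MvPolynomial (Fin 4) ℝ) × (Fin 3 → MvPolynomial (Fin 4) ℝ)) where
  carrier := { EH | EH ∈ TrefftzSpace p ε μ ∧ div4 EH.1 = 0 ∧ div4 EH.2 = 0 }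
  add_mem' := by
    rintro a b ⟨ha, ha1, ha2⟩ ⟨hb, hb1, hb2⟩
    refine ⟨add_mem ha hb, ?_, ?_⟩ <;>
    · show div4 (_ + _) = 0
      simp only [div4, Pi.add_apply, map_add] at *
      rw [show ∀ x y z u v w : MvPolynomial (Fin 4) ℝ,
        x + y + (z + u) + (v + w) = (x + z + v) + (y + u + w) by intros; ring]
      first
      | rw [ha1, hb1, add_zero]
      | rw [ha2, hb2, add_zero]
  zero_mem' := by
    refine ⟨zero_mem _, ?_, ?_⟩ <;> simp [div4]
  smul_mem' := by
    rintro c a ⟨ha, ha1, ha2⟩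
    refine ⟨Submodule.smul_mem _ c ha, ?_, ?_⟩ <;>
    · show div4 (c • _) = 0
      simp only [div4, Pi.smul_apply, Derivation.map_smul, ← smul_add] at *
      first
      | rw [ha1, smul_zero]
      | rw [ha2, smul_zero]

/-- Formal antiderivative in the variable `i` vanishing at `x_i = 0`. -/
def antiD (i : Fin 4) (f : MvPolynomial (Fin 4) ℝ) : MvPolynomial (Fin 4) ℝ :=
  ∑ m ∈ f.support, monomial (m + Finsupp.single i 1) (coeff m f / ((m i : ℝ) + 1))

lemma coeff_antiD_add (i : Fin 4) (f : MvPolynomial (Fin 4) ℝ) (n : Fin 4 →₀ ℕ) :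
    coeff (n + Finsupp.single i 1) (antiD i f) = coeff n f / ((n i : ℝ) + 1) := by
  classical
  simp only [antiD, coeff_sum, coeff_monomial, add_left_inj]
  rw [Finset.sum_ite_eq']
  split_ifs with h
  · rfl
  · rw [notMem_support_iff.1 h, zero_div]

lemma coeff_antiD_zero (i : Fin 4) (f : MvPolynomial (Fin 4) ℝ) (n : Fin 4 →₀ ℕ)
    (hn : n i = 0) : coeff n (antiD i f) = 0 := by
  classical
  simp only [antiD, coeff_sum, coeff_monomial]
  refine Finset.sum_eq_zero fun m _ => if_neg ?_
  rintro rfl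
  simp at hn

lemma exists_add_single (i : Fin 4) (n : Fin 4 →₀ ℕ) (hn : n i ≠ 0) :
    ∃ m : Fin 4 →₀ ℕ, n = m + Finsupp.single i 1 := by
  refine ⟨n - Finsupp.single i 1, ?_⟩
  rw [tsub_add_cancel_of_le]
  rw [Finsupp.single_le_iff]
  omega

lemma antiD_sub (i : Fin 4) (f g : MvPolynomial (Fin 4) ℝ) :
    antiD i (f - g) = antiD i f - antiD i g := by
  ext n
  by_cases hn : n i = 0
  · simp [coeff_antiD_zero i _ n hn]
  · obtain ⟨m, rfl⟩ := exists_add_single i n hn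
    simp [coeff_antiD_add, sub_div]

lemma pderiv_antiD (i : Fin 4) (f : MvPolynomial (Fin 4) ℝ) : pderiv i (antiD i f) = f := by
  ext n
  rw [coeff_pderiv, coeff_antiD_add]
  have : (n i : ℝ) + 1 ≠ 0 := by positivity
  field_simp

/-- Total degree `< q` and divisible by `t ^ k`. -/
def NB (k q : ℕ) (f : MvPolynomial (Fin 4) ℝ) : Prop :=
  ∀ m : Fin 4 →₀ ℕ, (q ≤ m 0 + m 1 + m 2 + m 3 ∨ m 3 < k) → coeff m f = 0

lemma NB.add {k q : ℕ} {f g : MvPolynomial (Fin 4) ℝ} (hf : NB k q f) (hg : NB k q g) :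
    NB k q (f + g) := fun m hm => by simp [hf m hm, hg m hm]

lemma NB.sub {k q : ℕ} {f g : MvPolynomial (Fin 4) ℝ} (hf : NB k q f) (hg : NB k q g) :
    NB k q (f - g) := fun m hm => by simp [hf m hm, hg m hm]

lemma NB.smul {k q : ℕ} {f : MvPolynomial (Fin 4) ℝ} (c : ℝ) (hf : NB k q f) :
    NB k q (c • f) := fun m hm => by simp [hf m hm]

lemma NB.pderiv {k q : ℕ} {f : MvPolynomial (Fin 4) ℝ} (hf : NB k (q + 1) f) (i : Fin 4)
    (hi : i ≠ 3) : NB k q (MvPolynomial.pderiv i f) := fun m hm => by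
  rw [coeff_pderiv, hf, zero_mul]
  fin_cases i <;> simp at hi ⊢ <;> omega

lemma NB.antiD {k q : ℕ} {f : MvPolynomial (Fin 4) ℝ} (hf : NB k q f) :
    NB (k + 1) (q + 1) (antiD 3 f) := fun m hm => by
  by_cases h3 : m 3 = 0
  · exact coeff_antiD_zero _ _ _ h3
  · obtain ⟨n, rfl⟩ := exists_add_single 3 m h3
    rw [coeff_antiD_add, hf, zero_div]
    simp at hm ⊢
    omega

lemma NB.curl {k q : ℕ} {F : Fin 3 → MvPolynomial (Fin 4) ℝ} (hF : ∀ i, NB k (q + 1) (F i))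
    (i : Fin 3) : NB k q (curl4 F i) := by
  fin_cases i
  · exact ((hF 2).pderiv 1 (by decide)).sub ((hF 1).pderiv 2 (by decide))
  · exact ((hF 0).pderiv 2 (by decide)).sub ((hF 2).pderiv 0 (by decide))
  · exact ((hF 1).pderiv 0 (by decide)).sub ((hF 0).pderiv 1 (by decide))

lemma NB.eq_zero {k : ℕ} {f : MvPolynomial (Fin 4) ℝ} (hf : NB k k f) : f = 0 := by
  ext m
  rw [hf m (by omega), coeff_zero]

lemma NB.mono {k l q : ℕ} {f : MvPolynomial (Fin 4) ℝ} (hf : NB k q f) (h : l ≤ k) :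
    NB l q f := fun m hm => hf m (by omega)

lemma NB_iff (p : ℕ) (f : MvPolynomial (Fin 4) ℝ) : NB 0 (p + 1) f ↔ f.totalDegree ≤ p := by
  have key : ∀ m : Fin 4 →₀ ℕ, (m.sum fun _ e => e) = m 0 + m 1 + m 2 + m 3 := by
    intro m
    rw [Finsupp.sum_fintype _ _ (fun _ => rfl), Fin.sum_univ_four]
  constructor
  · intro h
    rw [totalDegree]
    refine Finset.sup_le fun m hm => ?_
    rw [key]
    by_contra hc
    exact mem_support_iff.1 hm (h m (by omega))
  · intro h m hm
    by_contra hc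
    have := le_totalDegree (mem_support_iff.2 hc)
    rw [key] at this
    omega

lemma curl4_sub (F G : Fin 3 → MvPolynomial (Fin 4) ℝ) :
    curl4 (F - G) = curl4 F - curl4 G := by
  have h := curl4_add (F - G) G
  rw [sub_add_cancel] at h
  rw [h, add_sub_cancel_right]

lemma pderiv_comm4 (i j : Fin 4) (f : MvPolynomial (Fin 4) ℝ) :
    pderiv i (pderiv j f) = pderiv j (pderiv i f) := by
  ext m
  simp only [coeff_pderiv]
  rw [add_right_comm]
  by_cases h : i = j
  · subst h; rfl
  · have h' : j ≠ i := fun e => h e.symm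
    simp [Finsupp.single_apply, h, h']
    ring

lemma div4_curl4 (F : Fin 3 → MvPolynomial (Fin 4) ℝ) : div4 (curl4 F) = 0 := by
  simp only [div4, curl4, Matrix.cons_val_zero, Matrix.cons_val_one, Matrix.cons_val, map_sub]
  rw [pderiv_comm4 1 0, pderiv_comm4 2 0, pderiv_comm4 2 1]
  ring

lemma div4_smul (c : ℝ) (F : Fin 3 → MvPolynomial (Fin 4) ℝ) :
    div4 (c • F) = c • div4 F := by
  simp [div4, smul_add]

lemma pderiv_div4 (F : Fin 3 → MvPolynomial (Fin 4) ℝ) :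
    pderiv 3 (div4 F) = div4 (fun i => pderiv 3 (F i)) := by
  simp only [div4, map_add]
  rw [pderiv_comm4 3 0, pderiv_comm4 3 1, pderiv_comm4 3 2]

/-- A polynomial with vanishing `t`-derivative and vanishing `t = 0` part is zero. -/
lemma eq_zero_of_pderiv {f : MvPolynomial (Fin 4) ℝ} (i : Fin 4) (h : pderiv i f = 0)
    (h0 : ∀ m : Fin 4 →₀ ℕ, m i = 0 → coeff m f = 0) : f = 0 := by
  ext n
  by_cases hn : n i = 0
  · rw [h0 n hn, coeff_zero]
  · obtain ⟨m, rfl⟩ := exists_add_single i n hn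
    have := congrArg (coeff m) h
    rw [coeff_pderiv, coeff_zero] at this
    have h2 : (m i : ℝ) + 1 ≠ 0 := by positivity
    rw [coeff_zero]
    exact (mul_eq_zero.1 this).resolve_right h2

lemma NB_succ_of_pderiv {k q : ℕ} {f : MvPolynomial (Fin 4) ℝ} (hf : NB 1 q f)
    (h : NB k 0 (pderiv 3 f) ∨ ∀ m : Fin 4 →₀ ℕ, m 3 < k → coeff m (pderiv 3 f) = 0) :
    NB (k + 1) q f := by
  have h : ∀ m : Fin 4 →₀ ℕ, m 3 < k → coeff m (pderiv 3 f) = 0 := by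
    rcases h with h | h
    · exact fun m hm => h m (Or.inr hm)
    · exact h
  intro n hn
  by_cases h1 : q ≤ n 0 + n 1 + n 2 + n 3
  · exact hf n (Or.inl h1)
  by_cases hn3 : n 3 = 0
  · exact hf n (by omega)
  · obtain ⟨m, rfl⟩ := exists_add_single 3 n hn3
    have h3 := h m (by simp at hn; simp at h1; omega)
    rw [coeff_pderiv] at h3
    have h2 : (m 3 : ℝ) + 1 ≠ 0 := by positivity
    exact (mul_eq_zero.1 h3).resolve_right h2

/-- Uniqueness for the Cauchy problem. -/
lemma cauchy_unique {p : ℕ} {ε μ : ℝ} (hε : 0 < ε) (hμ : 0 < μ)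
    {E H : Fin 3 → MvPolynomial (Fin 4) ℝ}
    (hE : ∀ i, NB 1 (p + 1) (E i)) (hH : ∀ i, NB 1 (p + 1) (H i))
    (h1 : ∀ i, ε • pderiv 3 (E i) = curl4 H i) (h2 : ∀ i, μ • pderiv 3 (H i) = - curl4 E i) :
    E = 0 ∧ H = 0 := by
  have key : ∀ k, (∀ i, NB (k + 1) (p + 1) (E i)) ∧ (∀ i, NB (k + 1) (p + 1) (H i)) := by
    intro k
    induction k with
    | zero => exact ⟨hE, hH⟩
    | succ k ih =>
      refine ⟨fun i => NB_succ_of_pderiv (hE i) (Or.inr fun m hm => ?_),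
        fun i => NB_succ_of_pderiv (hH i) (Or.inr fun m hm => ?_)⟩
      · have a := NB.curl ih.2 i m (Or.inr hm)
        rw [← h1, coeff_smul] at a
        exact (mul_eq_zero.1 a).resolve_left hε.ne'
      · have a := NB.curl ih.1 i m (Or.inr hm)
        rw [← neg_eq_zero, ← coeff_neg, ← h2, coeff_smul] at a
        exact (mul_eq_zero.1 a).resolve_left hμ.ne'
  exact ⟨funext fun i => ((key p).1 i).eq_zero, funext fun i => ((key p).2 i).eq_zero⟩

/-- Picard iteration. -/
def picard (ε μ : ℝ) (u : (Fin 3 → MvPolynomial (Fin 4) ℝ) × (Fin 3 → MvPolynomial (Fin 4) ℝ)) :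
    ℕ → (Fin 3 → MvPolynomial (Fin 4) ℝ) × (Fin 3 → MvPolynomial (Fin 4) ℝ)
  | 0 => u
  | n + 1 => (fun i => u.1 i + antiD 3 (ε⁻¹ • curl4 (picard ε μ u n).2 i),
      fun i => u.2 i + antiD 3 ((-μ⁻¹) • curl4 (picard ε μ u n).1 i))

lemma picard_NB {p : ℕ} (ε μ : ℝ)
    {u : (Fin 3 → MvPolynomial (Fin 4) ℝ) × (Fin 3 → MvPolynomial (Fin 4) ℝ)}
    (hE : ∀ i, NB 0 (p + 1) (u.1 i)) (hH : ∀ i, NB 0 (p + 1) (u.2 i)) (n : ℕ) :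
    (∀ i, NB 0 (p + 1) ((picard ε μ u n).1 i)) ∧ (∀ i, NB 0 (p + 1) ((picard ε μ u n).2 i)) := by
  induction n with
  | zero => exact ⟨hE, hH⟩
  | succ n ih =>
    exact ⟨fun i => (hE i).add (((NB.curl ih.2 i).smul _).antiD.mono (Nat.zero_le _)),
      fun i => (hH i).add (((NB.curl ih.1 i).smul _).antiD.mono (Nat.zero_le _))⟩

lemma picard_diff {p : ℕ} (ε μ : ℝ)
    {u : (Fin 3 → MvPolynomial (Fin 4) ℝ) × (Fin 3 → MvPolynomial (Fin 4) ℝ)}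
    (hE : ∀ i, NB 0 (p + 1) (u.1 i)) (hH : ∀ i, NB 0 (p + 1) (u.2 i)) (n : ℕ) :
    (∀ i, NB n (p + 1) (((picard ε μ u (n + 1)).1 - (picard ε μ u n).1) i)) ∧
    (∀ i, NB n (p + 1) (((picard ε μ u (n + 1)).2 - (picard ε μ u n).2) i)) := by
  induction n with
  | zero =>
    have a := picard_NB ε μ hE hH 0
    have b := picard_NB ε μ hE hH 1
    exact ⟨fun i => (b.1 i).sub (a.1 i), fun i => (b.2 i).sub (a.2 i)⟩
  | succ n ih =>
    constructor
    · intro i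
      have := ((NB.curl ih.2 i).smul ε⁻¹).antiD
      rw [curl4_sub, Pi.sub_apply, smul_sub, antiD_sub] at this
      convert this using 1
      exact add_sub_add_left_eq_sub _ _ _
    · intro i
      have := ((NB.curl ih.1 i).smul (-μ⁻¹)).antiD
      rw [curl4_sub, Pi.sub_apply, smul_sub, antiD_sub] at this
      convert this using 1
      exact add_sub_add_left_eq_sub _ _ _

/-- Existence for the Cauchy problem. -/
lemma cauchy_exists {p : ℕ} {ε μ : ℝ} (hε : 0 < ε) (hμ : 0 < μ)
    {E0 H0 : Fin 3 → MvPolynomial (Fin 4) ℝ}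
    (hE : ∀ i, NB 0 (p + 1) (E0 i)) (hH : ∀ i, NB 0 (p + 1) (H0 i))
    (tE : ∀ i, pderiv 3 (E0 i) = 0) (tH : ∀ i, pderiv 3 (H0 i) = 0) :
    ∃ E H : Fin 3 → MvPolynomial (Fin 4) ℝ, (E, H) ∈ TrefftzSpace p ε μ ∧
      (∀ i (m : Fin 4 →₀ ℕ), m 3 = 0 → coeff m (E i) = coeff m (E0 i)) ∧
      (∀ i (m : Fin 4 →₀ ℕ), m 3 = 0 → coeff m (H i) = coeff m (H0 i)) := by
  have nb := picard_NB (u := (E0, H0)) ε μ hE hH (p + 1)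
  have df := picard_diff (u := (E0, H0)) ε μ hE hH (p + 1)
  set s := picard ε μ (E0, H0) (p + 1) with hs
  have e1 : ∀ i, s.1 i = E0 i + antiD 3 (ε⁻¹ • curl4 s.2 i) := by
    intro i
    have := (df.1 i).eq_zero
    rw [Pi.sub_apply, sub_eq_zero] at this
    exact this.symm
  have e2 : ∀ i, s.2 i = H0 i + antiD 3 ((-μ⁻¹) • curl4 s.1 i) := by
    intro i
    have := (df.2 i).eq_zero
    rw [Pi.sub_apply, sub_eq_zero] at this
    exact this.symm
  refine ⟨s.1, s.2, ⟨fun i => (NB_iff p _).1 (nb.1 i), fun i => (NB_iff p _).1 (nb.2 i),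
    fun i => ?_, fun i => ?_⟩, fun i m hm => ?_, fun i m hm => ?_⟩
  · show ε • pderiv 3 (s.1 i) = _
    rw [e1 i, map_add, tE, zero_add, pderiv_antiD, smul_smul, mul_inv_cancel₀ hε.ne', one_smul]
  · show μ • pderiv 3 (s.2 i) = _
    rw [e2 i, map_add, tH, zero_add, pderiv_antiD, smul_smul, mul_neg, mul_inv_cancel₀ hμ.ne',
      neg_smul, one_smul]
  · rw [e1 i, coeff_add, coeff_antiD_zero _ _ _ hm, add_zero]
  · rw [e2 i, coeff_add, coeff_antiD_zero _ _ _ hm, add_zero]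

lemma div4_eq_zero_of_init {F F0 : Fin 3 → MvPolynomial (Fin 4) ℝ}
    (h0 : div4 F0 = 0) (h : ∀ i (m : Fin 4 →₀ ℕ), m 3 = 0 → coeff m (F i) = coeff m (F0 i))
    (ht : pderiv 3 (div4 F) = 0) : div4 F = 0 := by
  refine eq_zero_of_pderiv 3 ht fun m hm => ?_
  have e : coeff m (div4 F) = coeff m (div4 F0) := by
    simp only [div4, coeff_add, coeff_pderiv]
    rw [h, h, h] <;> simp [hm]
  rw [e, h0, coeff_zero]

/-- Exponents of `(x₁, x₂, x₃)`-monomials of degree at most `p`. -/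
def QS (p : ℕ) : Finset (Fin 4 →₀ ℕ) :=
  (Finset.range (p + 1)).biUnion fun n => Finset.finsuppAntidiag {0, 1, 2} n

/-- Exponents of `(x₂, x₃)`-monomials of degree at most `p`. -/
def RS (p : ℕ) : Finset (Fin 4 →₀ ℕ) :=
  (Finset.range (p + 1)).biUnion fun n => Finset.finsuppAntidiag {1, 2} n

lemma mem_QS {p : ℕ} {m : Fin 4 →₀ ℕ} : m ∈ QS p ↔ m 3 = 0 ∧ m 0 + m 1 + m 2 ≤ p := by
  simp only [QS, Finset.mem_biUnion, Finset.mem_range, Finset.mem_finsuppAntidiag,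
    Finset.subset_iff, Finsupp.mem_support_iff, Finset.mem_insert, Finset.mem_singleton]
  simp only [Fin.forall_fin_succ]
  simp
  rw [← add_assoc]
  constructor <;> intro h <;> constructor <;> [tauto; omega; omega; tauto]

lemma mem_RS {p : ℕ} {m : Fin 4 →₀ ℕ} :
    m ∈ RS p ↔ m 3 = 0 ∧ m 0 = 0 ∧ m 1 + m 2 ≤ p := by
  simp only [RS, Finset.mem_biUnion, Finset.mem_range, Finset.mem_finsuppAntidiag,
    Finset.subset_iff, Finsupp.mem_support_iff, Finset.mem_insert, Finset.mem_singleton]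
  simp only [Fin.forall_fin_succ]
  simp
  constructor
  · rintro ⟨h1, h2, h3⟩
    exact ⟨h3, h2, by omega⟩
  · rintro ⟨h1, h2, h3⟩
    exact ⟨by omega, h2, h1⟩

lemma card_antidiag_union (s : Finset (Fin 4)) (p : ℕ) :
    ((Finset.range (p + 1)).biUnion fun n => Finset.finsuppAntidiag s n).card =
      ∑ n ∈ Finset.range (p + 1), (s.card + n - 1).choose n := by
  rw [Finset.card_biUnion]
  · refine Finset.sum_congr rfl fun n _ => ?_
    rw [Finset.card_finsuppAntidiag_nat_eq_choose]
  · intro a _ b _ hab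
    refine Finset.disjoint_left.2 ?_
    intro f hf hg
    rw [Finset.mem_finsuppAntidiag] at hf hg
    exact hab (hf.1.symm.trans hg.1)

lemma card_RS (p : ℕ) : 2 * (RS p).card = (p + 1) * (p + 2) := by
  rw [RS, card_antidiag_union, show ({1, 2} : Finset (Fin 4)).card = 2 from rfl]
  induction p with
  | zero => simp
  | succ p ih =>
    rw [Finset.sum_range_succ, mul_add, ih, show 2 + (p + 1) - 1 = (p + 1) + 1 by omega,
      Nat.choose_succ_self_right]
    ring

lemma card_QS (p : ℕ) : 6 * (QS p).card = (p + 1) * (p + 2) * (p + 3) := by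
  rw [QS, card_antidiag_union, show ({0, 1, 2} : Finset (Fin 4)).card = 3 from rfl]
  induction p with
  | zero => simp
  | succ p ih =>
    rw [Finset.sum_range_succ, mul_add, ih, show 3 + (p + 1) - 1 = 2 + (p + 1) by omega,
      ← Nat.choose_symm_add]
    have h2 : 2 * (2 + (p + 1)).choose 2 = (p + 3) * (p + 2) := by
      rw [Nat.choose_two_right, show 2 + (p + 1) = p + 3 by omega, show p + 3 - 1 = p + 2 by omega]
      refine Nat.mul_div_cancel' ?_
      have := Nat.even_mul_succ_self (p + 2)
      rw [mul_comm]
      exact this.two_dvd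
    have : 6 * (2 + (p + 1)).choose 2 = 3 * ((p + 3) * (p + 2)) := by omega
    rw [this]
    ring

/-- The polynomial with given coefficients on a finite set of exponents. -/
def mkPoly (S : Finset (Fin 4 →₀ ℕ)) (c : S → ℝ) : MvPolynomial (Fin 4) ℝ :=
  ∑ m : S, monomial (m : Fin 4 →₀ ℕ) (c m)

lemma coeff_mkPoly (S : Finset (Fin 4 →₀ ℕ)) (c : S → ℝ) (m : S) :
    coeff (m : Fin 4 →₀ ℕ) (mkPoly S c) = c m := by
  classical
  simp [mkPoly, coeff_sum, coeff_monomial, Subtype.coe_inj]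

lemma coeff_mkPoly_of_notMem (S : Finset (Fin 4 →₀ ℕ)) (c : S → ℝ) (m : Fin 4 →₀ ℕ)
    (hm : m ∉ S) : coeff m (mkPoly S c) = 0 := by
  classical
  simp only [mkPoly, coeff_sum, coeff_monomial]
  refine Finset.sum_eq_zero fun n _ => if_neg ?_
  rintro rfl
  exact hm n.2

lemma pderiv_eq_zero_of_coeff {f : MvPolynomial (Fin 4) ℝ} (i : Fin 4)
    (h : ∀ m : Fin 4 →₀ ℕ, m i ≠ 0 → coeff m f = 0) : pderiv i f = 0 := by
  ext m
  rw [coeff_pderiv, h, zero_mul, coeff_zero]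
  simp

/-- Divergence-free initial data with prescribed free coefficients. -/
lemma init_exists (p : ℕ) (c : (RS p → ℝ) × (QS p → ℝ) × (QS p → ℝ)) :
    ∃ F : Fin 3 → MvPolynomial (Fin 4) ℝ, (∀ i, NB 0 (p + 1) (F i)) ∧
      (∀ i, pderiv 3 (F i) = 0) ∧ div4 F = 0 ∧ (∀ m : RS p, coeff m (F 0) = c.1 m) ∧
      (∀ m : QS p, coeff m (F 1) = c.2.1 m) ∧ (∀ m : QS p, coeff m (F 2) = c.2.2 m) := by
  set f1 := mkPoly (QS p) c.2.1 with hf1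
  set f2 := mkPoly (QS p) c.2.2 with hf2
  set g := pderiv 1 f1 + pderiv 2 f2 with hg
  have nQ : ∀ d : QS p → ℝ, NB 0 (p + 1) (mkPoly (QS p) d) := fun d m hm =>
    coeff_mkPoly_of_notMem _ _ _ (by rw [mem_QS]; omega)
  have tQ : ∀ d : QS p → ℝ, pderiv 3 (mkPoly (QS p) d) = 0 := fun d =>
    pderiv_eq_zero_of_coeff 3 fun m hm => coeff_mkPoly_of_notMem _ _ _ (by rw [mem_QS]; omega)
  have nR : NB 0 (p + 1) (mkPoly (RS p) c.1) := fun m hm =>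
    coeff_mkPoly_of_notMem _ _ _ (by rw [mem_RS]; omega)
  have tR : pderiv 3 (mkPoly (RS p) c.1) = 0 :=
    pderiv_eq_zero_of_coeff 3 fun m hm => coeff_mkPoly_of_notMem _ _ _ (by rw [mem_RS]; omega)
  have xR : pderiv 0 (mkPoly (RS p) c.1) = 0 :=
    pderiv_eq_zero_of_coeff 0 fun m hm => coeff_mkPoly_of_notMem _ _ _ (by rw [mem_RS]; omega)
  have ng : NB 0 p g := ((nQ _).pderiv 1 (by decide)).add ((nQ _).pderiv 2 (by decide))
  have tg : pderiv 3 g = 0 := by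
    rw [hg, map_add, pderiv_comm4 3 1, pderiv_comm4 3 2, hf1, hf2, tQ, tQ]
    simp
  have nJ : NB 0 (p + 1) (antiD 0 g) := by
    intro m hm
    by_cases h0 : m 0 = 0
    · exact coeff_antiD_zero _ _ _ h0
    · obtain ⟨n, rfl⟩ := exists_add_single 0 m h0
      rw [coeff_antiD_add, ng, zero_div]
      simp at hm ⊢
      omega
  have tJ : pderiv 3 (antiD 0 g) = 0 := by
    refine eq_zero_of_pderiv 0 ?_ fun m hm => ?_
    · rw [pderiv_comm4, pderiv_antiD, tg]
    · rw [coeff_pderiv, coeff_antiD_zero, zero_mul]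
      simp [hm]
  refine ⟨![mkPoly (RS p) c.1 - antiD 0 g, f1, f2], fun i => ?_, fun i => ?_, ?_, fun m => ?_,
    fun m => coeff_mkPoly _ _ m, fun m => coeff_mkPoly _ _ m⟩
  · fin_cases i
    · exact nR.sub nJ
    · exact nQ _
    · exact nQ _
  · fin_cases i
    · show pderiv 3 (mkPoly (RS p) c.1 - antiD 0 g) = 0
      rw [map_sub, tR, tJ, sub_zero]
    · exact tQ _
    · exact tQ _
  · show pderiv 0 (mkPoly (RS p) c.1 - antiD 0 g) + pderiv 1 f1 + pderiv 2 f2 = 0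
    rw [map_sub, xR, pderiv_antiD, hg]
    ring
  · show coeff m (mkPoly (RS p) c.1 - antiD 0 g) = _
    rw [coeff_sub, coeff_mkPoly, coeff_antiD_zero _ _ _ (mem_RS.1 m.2).2.1, sub_zero]

/-- Free coefficients of the initial value of a vector field. -/
def dataMap (p : ℕ) : (Fin 3 → MvPolynomial (Fin 4) ℝ) →ₗ[ℝ]
    ((RS p → ℝ) × (QS p → ℝ) × (QS p → ℝ)) where
  toFun F := (fun m => coeff m (F 0), fun m => coeff m (F 1), fun m => coeff m (F 2))
  map_add' F G := by ext <;> simp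
  map_smul' c F := by ext <;> simp

lemma NB_one_of_data {p : ℕ} {F : Fin 3 → MvPolynomial (Fin 4) ℝ} (hF : ∀ i, NB 0 (p + 1) (F i))
    (hd : div4 F = 0) (h : dataMap p F = 0) (i : Fin 3) : NB 1 (p + 1) (F i) := by
  have a0 : ∀ m : RS p, coeff m (F 0) = 0 := fun m => congrFun (congrArg Prod.fst h) m
  have a1 : ∀ m : QS p, coeff m (F 1) = 0 := fun m =>
    congrFun (congrArg (fun x => x.2.1) h) m
  have a2 : ∀ m : QS p, coeff m (F 2) = 0 := fun m =>
    congrFun (congrArg (fun x => x.2.2) h) m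
  have b1 : NB 1 (p + 1) (F 1) := by
    intro m hm
    by_cases hq : m ∈ QS p
    · exact a1 ⟨m, hq⟩
    · rw [mem_QS] at hq
      exact hF 1 m (by omega)
  have b2 : NB 1 (p + 1) (F 2) := by
    intro m hm
    by_cases hq : m ∈ QS p
    · exact a2 ⟨m, hq⟩
    · rw [mem_QS] at hq
      exact hF 2 m (by omega)
  have b0 : NB 1 (p + 1) (F 0) := by
    intro m hm
    by_cases hd' : p + 1 ≤ m 0 + m 1 + m 2 + m 3
    · exact hF 0 m (Or.inl hd')
    by_cases hm0 : m 0 = 0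
    · exact a0 ⟨m, mem_RS.2 (by omega)⟩
    · obtain ⟨n, rfl⟩ := exists_add_single 0 m hm0
      have e := congrArg (coeff n) hd
      have hn : n 3 < 1 := by simp at hm hd'; simp; omega
      simp only [div4, coeff_add, coeff_zero] at e
      rw [b1.pderiv 1 (by decide) n (Or.inr hn), b2.pderiv 2 (by decide) n (Or.inr hn),
        add_zero, add_zero, coeff_pderiv] at e
      have h2 : (n 0 : ℝ) + 1 ≠ 0 := by positivity
      exact (mul_eq_zero.1 e).resolve_right h2
  fin_cases i
  · exact b0
  · exact b1
  · exact b2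

/-- The divergence-free Trefftz space `𝕋̃_p` is finite dimensional and its
dimension `d` satisfies `3·d = (p+1)(p+2)(2p+9)`. -/
theorem trefftz_div_free_finrank (p : ℕ) (ε μ : ℝ) (hε : 0 < ε) (hμ : 0 < μ) :
    FiniteDimensional ℝ (TrefftzDivFree p ε μ) ∧
      3 * Module.finrank ℝ (TrefftzDivFree p ε μ) = (p + 1) * (p + 2) * (2 * p + 9) := by
  set Φ : TrefftzDivFree p ε μ →ₗ[ℝ] (((RS p → ℝ) × (QS p → ℝ) × (QS p → ℝ)) ×
      ((RS p → ℝ) × (QS p → ℝ) × (QS p → ℝ))) :=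
    ((dataMap p).prodMap (dataMap p)).comp (TrefftzDivFree p ε μ).subtype with hΦ
  have inj : Function.Injective Φ := by
    rw [injective_iff_map_eq_zero]
    rintro ⟨⟨E, H⟩, ⟨hE, hH, h1, h2⟩, dE, dH⟩ h
    have hh1 : dataMap p E = 0 := congrArg Prod.fst h
    have hh2 : dataMap p H = 0 := congrArg Prod.snd h
    obtain ⟨e, f⟩ := cauchy_unique hε hμ
      (NB_one_of_data (fun i => (NB_iff p _).2 (hE i)) dE hh1)
      (NB_one_of_data (fun i => (NB_iff p _).2 (hH i)) dH hh2) h1 h2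
    exact Subtype.ext (Prod.ext e f)
  have surj : Function.Surjective Φ := by
    rintro ⟨c, d⟩
    obtain ⟨E0, nE, tE, dE, cE0, cE1, cE2⟩ := init_exists p c
    obtain ⟨H0, nH, tH, dH, cH0, cH1, cH2⟩ := init_exists p d
    obtain ⟨E, H, hEH, iE, iH⟩ := cauchy_exists hε hμ nE nH tE tH
    have zE : div4 E = 0 := by
      refine div4_eq_zero_of_init dE iE ?_
      have e : ε • pderiv 3 (div4 E) = 0 := by
        rw [pderiv_div4, ← div4_smul, ← div4_curl4 H]
        exact congrArg div4 (funext fun i => hEH.2.2.1 i)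
      exact (smul_eq_zero.1 e).resolve_left hε.ne'
    have zH : div4 H = 0 := by
      refine div4_eq_zero_of_init dH iH ?_
      have e : (-μ) • pderiv 3 (div4 H) = 0 := by
        rw [pderiv_div4, ← div4_smul, ← div4_curl4 E]
        refine congrArg div4 (funext fun i => ?_)
        have := hEH.2.2.2 i
        rw [Pi.smul_apply, neg_smul]
        exact neg_eq_iff_eq_neg.2 this
      exact (smul_eq_zero.1 e).resolve_left (neg_ne_zero.2 hμ.ne')
    refine ⟨⟨(E, H), hEH, zE, zH⟩, ?_⟩
    refine Prod.ext (Prod.ext ?_ (Prod.ext ?_ ?_)) (Prod.ext ?_ (Prod.ext ?_ ?_)) <;> funext m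
    · exact (iE 0 m (mem_RS.1 m.2).1).trans (cE0 m)
    · exact (iE 1 m (mem_QS.1 m.2).1).trans (cE1 m)
    · exact (iE 2 m (mem_QS.1 m.2).1).trans (cE2 m)
    · exact (iH 0 m (mem_RS.1 m.2).1).trans (cH0 m)
    · exact (iH 1 m (mem_QS.1 m.2).1).trans (cH1 m)
    · exact (iH 2 m (mem_QS.1 m.2).1).trans (cH2 m)
  have e := LinearEquiv.ofBijective Φ ⟨inj, surj⟩
  refine ⟨Module.Finite.equiv e.symm, ?_⟩
  rw [e.finrank_eq]
  simp only [Module.finrank_prod, Module.finrank_fintype_fun_eq_card, Fintype.card_coe]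
  have h1 := card_RS p
  have h2 := card_QS p
  linear_combination 3 * h1 + 2 * h2

end
end

section
/- Let p ∈ ℕ and let ε, μ > 0 be real constants. The two-dimensional Trefftz space 𝕋_p^{2D} is a finite-dimensional real vector space whose dimension d satisfies 2·d = 3(p+1)(p+2). -/
open MvPolynomial

noncomputable section

/-- The two-dimensional (transverse-magnetic) Trefftz space `𝕋_p^{2D}`: triples
`(E₃, H₁, H₂)` of polynomials in the variables `(x, y, t)` of total degree at most `p`
satisfying the TM-mode Maxwell equations `ε ∂ₜ E₃ = ∂ₓ H₂ - ∂_y H₁`,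
`μ ∂ₜ H₁ = - ∂_y E₃` and `μ ∂ₜ H₂ = ∂ₓ E₃`. -/
def Trefftz2D (p : ℕ) (ε μ : ℝ) :
    Submodule ℝ (MvPolynomial (Fin 3) ℝ × MvPolynomial (Fin 3) ℝ × MvPolynomial (Fin 3) ℝ) where
  carrier := { u |
    u.1.totalDegree ≤ p ∧ u.2.1.totalDegree ≤ p ∧ u.2.2.totalDegree ≤ p ∧
    ε • pderiv 2 u.1 = pderiv 0 u.2.2 - pderiv 1 u.2.1 ∧
    μ • pderiv 2 u.2.1 = - pderiv 1 u.1 ∧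
    μ • pderiv 2 u.2.2 = pderiv 0 u.1 }
  add_mem' := by
    rintro a b ⟨ha1, ha2, ha3, ha4, ha5, ha6⟩ ⟨hb1, hb2, hb3, hb4, hb5, hb6⟩
    refine ⟨(totalDegree_add _ _).trans (max_le ha1 hb1),
      (totalDegree_add _ _).trans (max_le ha2 hb2),
      (totalDegree_add _ _).trans (max_le ha3 hb3), ?_, ?_, ?_⟩
    · show ε • pderiv 2 (a.1 + b.1) = pderiv 0 (a.2.2 + b.2.2) - pderiv 1 (a.2.1 + b.2.1)
      rw [map_add, map_add, map_add, smul_add, ha4, hb4]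
      ring
    · show μ • pderiv 2 (a.2.1 + b.2.1) = - pderiv 1 (a.1 + b.1)
      rw [map_add, map_add, smul_add, ha5, hb5]
      ring
    · show μ • pderiv 2 (a.2.2 + b.2.2) = pderiv 0 (a.1 + b.1)
      rw [map_add, map_add, smul_add, ha6, hb6]
  zero_mem' := by
    refine ⟨?_, ?_, ?_, ?_, ?_, ?_⟩ <;> simp
  smul_mem' := by
    rintro c a ⟨ha1, ha2, ha3, ha4, ha5, ha6⟩
    refine ⟨(totalDegree_smul_le c _).trans ha1, (totalDegree_smul_le c _).trans ha2,
      (totalDegree_smul_le c _).trans ha3, ?_, ?_, ?_⟩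
    · show ε • pderiv 2 (c • a.1) = pderiv 0 (c • a.2.2) - pderiv 1 (c • a.2.1)
      rw [Derivation.map_smul, Derivation.map_smul, Derivation.map_smul, smul_comm, ha4,
        smul_sub]
    · show μ • pderiv 2 (c • a.2.1) = - pderiv 1 (c • a.1)
      rw [Derivation.map_smul, Derivation.map_smul, smul_comm, ha5, smul_neg]
    · show μ • pderiv 2 (c • a.2.2) = pderiv 0 (c • a.1)
      rw [Derivation.map_smul, Derivation.map_smul, smul_comm, ha6]

def tIdx (a b c : ℕ) : Fin 3 →₀ ℕ :=
  Finsupp.single 0 a + Finsupp.single 1 b + Finsupp.single 2 c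

theorem tIdx_self (m : Fin 3 →₀ ℕ) : tIdx (m 0) (m 1) (m 2) = m := by
  ext i
  fin_cases i <;> simp [tIdx]

theorem tIdx_zero (a b c : ℕ) : tIdx a b c 0 = a := by simp [tIdx]
theorem tIdx_one (a b c : ℕ) : tIdx a b c 1 = b := by simp [tIdx]
theorem tIdx_two (a b c : ℕ) : tIdx a b c 2 = c := by simp [tIdx]

/-- Coefficient of `x^a y^b t^c`. -/
def tCo (f : MvPolynomial (Fin 3) ℝ) (a b c : ℕ) : ℝ := coeff (tIdx a b c) f

theorem tCo_ext {f g : MvPolynomial (Fin 3) ℝ} (h : ∀ a b c, tCo f a b c = tCo g a b c) :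
    f = g := by
  ext m
  have := h (m 0) (m 1) (m 2)
  simpa only [tCo, tIdx_self] using this

theorem tCo_add (f g : MvPolynomial (Fin 3) ℝ) (a b c : ℕ) :
    tCo (f + g) a b c = tCo f a b c + tCo g a b c := by simp [tCo]
theorem tCo_sub (f g : MvPolynomial (Fin 3) ℝ) (a b c : ℕ) :
    tCo (f - g) a b c = tCo f a b c - tCo g a b c := by simp [tCo]
theorem tCo_neg (f : MvPolynomial (Fin 3) ℝ) (a b c : ℕ) :
    tCo (-f) a b c = - tCo f a b c := by simp [tCo]
theorem tCo_smul (r : ℝ) (f : MvPolynomial (Fin 3) ℝ) (a b c : ℕ) :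
    tCo (r • f) a b c = r * tCo f a b c := by simp [tCo]

theorem coeff_pderiv_aux (i : Fin 3) (f : MvPolynomial (Fin 3) ℝ) (m : Fin 3 →₀ ℕ) :
    coeff m (pderiv i f) = (m i + 1) * coeff (m + Finsupp.single i 1) f := by
  induction f using MvPolynomial.induction_on' with
  | add p q hp hq => simp [hp, hq, mul_add]
  | monomial s r =>
    rw [pderiv_monomial, coeff_monomial, coeff_monomial]
    by_cases h : s = m + Finsupp.single i 1
    · subst h
      simp [mul_comm]
    · rw [if_neg h, mul_zero]
      split_ifs with h2
      · have : s i = 0 := by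
          by_contra h3
          apply h
          rw [← h2]
          ext j
          by_cases hj : j = i
          · subst hj
            simp
            omega
          · simp [Finsupp.single_apply, Ne.symm hj]
        simp [this]
      · rfl

theorem tCo_pderiv0 (f : MvPolynomial (Fin 3) ℝ) (a b c : ℕ) :
    tCo (pderiv 0 f) a b c = (a + 1) * tCo f (a + 1) b c := by
  rw [tCo, coeff_pderiv_aux, tIdx_zero, tCo]
  congr 2
  ext i
  fin_cases i <;> simp [tIdx]
theorem tCo_pderiv1 (f : MvPolynomial (Fin 3) ℝ) (a b c : ℕ) :
    tCo (pderiv 1 f) a b c = (b + 1) * tCo f a (b + 1) c := by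
  rw [tCo, coeff_pderiv_aux, tIdx_one, tCo]
  congr 2
  ext i
  fin_cases i <;> simp [tIdx]
theorem tCo_pderiv2 (f : MvPolynomial (Fin 3) ℝ) (a b c : ℕ) :
    tCo (pderiv 2 f) a b c = (c + 1) * tCo f a b (c + 1) := by
  rw [tCo, coeff_pderiv_aux, tIdx_two, tCo]
  congr 2
  ext i
  fin_cases i <;> simp [tIdx]

theorem totalDegree_iff_tCo (f : MvPolynomial (Fin 3) ℝ) (p : ℕ) :
    f.totalDegree ≤ p ↔ ∀ a b c, p < a + b + c → tCo f a b c = 0 := by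
  have hs : ∀ m : Fin 3 →₀ ℕ, (m.sum fun _ e => e) = m 0 + m 1 + m 2 := by
    intro m
    rw [Finsupp.sum_fintype _ _ (by simp), Fin.sum_univ_three]
  rw [MvPolynomial.totalDegree, Finset.sup_le_iff]
  constructor
  · intro h a b c hp
    by_contra h0
    have := h (tIdx a b c) (by simpa [tCo] using h0)
    rw [hs, tIdx_zero, tIdx_one, tIdx_two] at this
    omega
  · intro h m hm
    rw [hs]
    by_contra hlt
    have := h (m 0) (m 1) (m 2) (by omega)
    rw [tCo, tIdx_self] at this
    simp [this] at hm

def tMk (p : ℕ) (F : ℕ → ℕ → ℕ → ℝ) : MvPolynomial (Fin 3) ℝ :=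
  ∑ m ∈ Finset.Iic (tIdx p p p), monomial m (F (m 0) (m 1) (m 2))

theorem tCo_tMk (p : ℕ) (F : ℕ → ℕ → ℕ → ℝ)
    (hF : ∀ a b c, p < a + b + c → F a b c = 0) (a b c : ℕ) :
    tCo (tMk p F) a b c = F a b c := by
  rw [tCo, tMk, coeff_sum]
  simp only [coeff_monomial]
  rw [Finset.sum_ite_eq', tIdx_zero, tIdx_one, tIdx_two]
  split_ifs with h
  · rfl
  · rw [hF]
    by_contra h2
    apply h
    rw [Finset.mem_Iic, Finsupp.le_def]
    intro i
    fin_cases i <;> simp [tIdx] <;> omega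

/-- Taylor coefficients in time of the solution with given initial data. -/
def tRec (ε μ : ℝ) (g : ℕ → ℕ → ℝ × ℝ × ℝ) : ℕ → ℕ → ℕ → ℝ × ℝ × ℝ
  | 0, a, b => g a b
  | c + 1, a, b =>
    (((a + 1) * (tRec ε μ g c (a + 1) b).2.2 - (b + 1) * (tRec ε μ g c a (b + 1)).2.1)
        / (ε * (c + 1)),
      -((b + 1) * (tRec ε μ g c a (b + 1)).1) / (μ * (c + 1)),
      ((a + 1) * (tRec ε μ g c (a + 1) b).1) / (μ * (c + 1)))

theorem tRec_vanish (ε μ : ℝ) (g : ℕ → ℕ → ℝ × ℝ × ℝ) (p : ℕ)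
    (hg : ∀ a b, p < a + b → g a b = 0) (c : ℕ) :
    ∀ a b, p < a + b + c → tRec ε μ g c a b = 0 := by
  induction c with
  | zero => intro a b h; exact hg a b (by omega)
  | succ c ih =>
    intro a b h
    rw [tRec, ih (a + 1) b (by omega), ih a (b + 1) (by omega)]
    simp

theorem mem_iff_tCo (p : ℕ) (ε μ : ℝ)
    (u : MvPolynomial (Fin 3) ℝ × MvPolynomial (Fin 3) ℝ × MvPolynomial (Fin 3) ℝ) :
    u ∈ Trefftz2D p ε μ ↔
    (∀ a b c, p < a + b + c → tCo u.1 a b c = 0) ∧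
    (∀ a b c, p < a + b + c → tCo u.2.1 a b c = 0) ∧
    (∀ a b c, p < a + b + c → tCo u.2.2 a b c = 0) ∧
    (∀ a b c : ℕ, ε * ((c + 1) * tCo u.1 a b (c + 1)) =
      (a + 1) * tCo u.2.2 (a + 1) b c - (b + 1) * tCo u.2.1 a (b + 1) c) ∧
    (∀ a b c : ℕ, μ * ((c + 1) * tCo u.2.1 a b (c + 1)) = - ((b + 1) * tCo u.1 a (b + 1) c)) ∧
    (∀ a b c : ℕ, μ * ((c + 1) * tCo u.2.2 a b (c + 1)) = (a + 1) * tCo u.1 (a + 1) b c) := by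
  have key : ∀ f g : MvPolynomial (Fin 3) ℝ, f = g ↔ ∀ a b c, tCo f a b c = tCo g a b c :=
    fun f g => ⟨fun h => by simp [h], tCo_ext⟩
  change (_ ∧ _ ∧ _ ∧ _ ∧ _ ∧ _) ↔ _
  rw [totalDegree_iff_tCo, totalDegree_iff_tCo, totalDegree_iff_tCo, key, key, key]
  simp only [tCo_sub, tCo_neg, tCo_smul, tCo_pderiv0, tCo_pderiv1, tCo_pderiv2]

/-- Index set for the initial data. -/
abbrev TIx (p : ℕ) := Σ i : Fin (p + 1), Fin (i.1 + 1)

/-- Restriction to time zero. -/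
def tRes (p : ℕ) (ε μ : ℝ) : Trefftz2D p ε μ →ₗ[ℝ] (TIx p → ℝ × ℝ × ℝ) where
  toFun u := fun k =>
    (tCo u.1.1 k.2.1 (k.1.1 - k.2.1) 0, tCo u.1.2.1 k.2.1 (k.1.1 - k.2.1) 0,
      tCo u.1.2.2 k.2.1 (k.1.1 - k.2.1) 0)
  map_add' u v := by
    funext k
    simp [tCo_add]
  map_smul' r u := by
    funext k
    simp [tCo_smul]

theorem tRes_inj (p : ℕ) (ε μ : ℝ) (hε : 0 < ε) (hμ : 0 < μ) :
    Function.Injective (tRes p ε μ) := by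
  rw [injective_iff_map_eq_zero]
  rintro ⟨u, hu⟩ h
  obtain ⟨d1, d2, d3, e1, e2, e3⟩ := (mem_iff_tCo p ε μ u).1 hu
  have main : ∀ c a b, tCo u.1 a b c = 0 ∧ tCo u.2.1 a b c = 0 ∧ tCo u.2.2 a b c = 0 := by
    intro c
    induction c with
    | zero =>
      intro a b
      by_cases hp : p < a + b
      · exact ⟨d1 _ _ _ (by omega), d2 _ _ _ (by omega), d3 _ _ _ (by omega)⟩
      · have := congrFun h ⟨⟨a + b, by omega⟩, ⟨a, by simp⟩⟩
        simpa [tRes] using this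
    | succ c ih =>
      intro a b
      have hc : (c : ℝ) + 1 ≠ 0 := by positivity
      have h1 := e1 a b c
      have h2 := e2 a b c
      have h3 := e3 a b c
      rw [(ih (a + 1) b).2.2, (ih a (b + 1)).2.1] at h1
      rw [(ih a (b + 1)).1] at h2
      rw [(ih (a + 1) b).1] at h3
      simp only [mul_zero, sub_zero, neg_zero, mul_eq_zero, hc, hε.ne', hμ.ne', false_or]
        at h1 h2 h3
      exact ⟨h1, h2, h3⟩
  have z : ∀ f : MvPolynomial (Fin 3) ℝ, (∀ a b c, tCo f a b c = 0) → f = 0 := by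
    intro f hf
    apply tCo_ext
    intro a b c
    rw [hf]
    simp [tCo]
  apply Subtype.ext
  exact Prod.ext (z _ fun a b c => (main c a b).1)
    (Prod.ext (z _ fun a b c => (main c a b).2.1) (z _ fun a b c => (main c a b).2.2))

theorem tRes_surj (p : ℕ) (ε μ : ℝ) (hε : 0 < ε) (hμ : 0 < μ) :
    Function.Surjective (tRes p ε μ) := by
  intro d
  let g : ℕ → ℕ → ℝ × ℝ × ℝ := fun a b =>
    if h : a + b ≤ p then d ⟨⟨a + b, by omega⟩, ⟨a, by simp⟩⟩ else 0
  have hg : ∀ a b, p < a + b → g a b = 0 := fun a b h => dif_neg (by omega)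
  have hv := fun a b c h => tRec_vanish ε μ g p hg c a b h
  let F1 : ℕ → ℕ → ℕ → ℝ := fun a b c => (tRec ε μ g c a b).1
  let F2 : ℕ → ℕ → ℕ → ℝ := fun a b c => (tRec ε μ g c a b).2.1
  let F3 : ℕ → ℕ → ℕ → ℝ := fun a b c => (tRec ε μ g c a b).2.2
  have v1 : ∀ a b c, p < a + b + c → F1 a b c = 0 := fun a b c h => by simp [F1, hv a b c h]
  have v2 : ∀ a b c, p < a + b + c → F2 a b c = 0 := fun a b c h => by simp [F2, hv a b c h]
  have v3 : ∀ a b c, p < a + b + c → F3 a b c = 0 := fun a b c h => by simp [F3, hv a b c h]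
  have c1 := tCo_tMk p F1 v1
  have c2 := tCo_tMk p F2 v2
  have c3 := tCo_tMk p F3 v3
  refine ⟨⟨(tMk p F1, tMk p F2, tMk p F3), (mem_iff_tCo p ε μ _).2 ?_⟩, ?_⟩
  · simp only [c1, c2, c3]
    refine ⟨v1, v2, v3, ?_, ?_, ?_⟩
    all_goals
      intro a b c
      have hc : (c : ℝ) + 1 ≠ 0 := by positivity
      have := hε.ne'
      have := hμ.ne'
      simp only [F1, F2, F3]
      conv_lhs => rw [tRec]
      field_simp
  · funext ⟨⟨n, hn⟩, ⟨j, hj⟩⟩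
    simp only [tRes, LinearMap.coe_mk, AddHom.coe_mk, c1, c2, c3, F1, F2, F3, tRec]
    change g j (n - j) = _
    have hj' : j < n + 1 := hj
    obtain ⟨b, rfl⟩ : ∃ b, n = j + b := ⟨n - j, by omega⟩
    have : j + b - j = b := by omega
    rw [this]
    exact dif_pos (by omega)

/-- The two-dimensional Trefftz space `𝕋_p^{2D}` is finite dimensional and its
dimension `d` satisfies `2·d = 3(p+1)(p+2)`. -/
theorem trefftz2D_finrank (p : ℕ) (ε μ : ℝ) (hε : 0 < ε) (hμ : 0 < μ) :
    FiniteDimensional ℝ (Trefftz2D p ε μ) ∧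
      2 * Module.finrank ℝ (Trefftz2D p ε μ) = 3 * ((p + 1) * (p + 2)) := by
  let e := LinearEquiv.ofBijective (tRes p ε μ) ⟨tRes_inj p ε μ hε hμ, tRes_surj p ε μ hε hμ⟩
  refine ⟨Module.Finite.equiv e.symm, ?_⟩
  rw [e.finrank_eq, Module.finrank_pi_fintype]
  simp only [Module.finrank_prod, Module.finrank_self, Finset.sum_const, Finset.card_univ,
    Fintype.card_sigma, Fintype.card_fin, smul_eq_mul]
  rw [Fin.sum_univ_eq_sum_range (fun i => i + 1) (p + 1)]
  have : ∀ n : ℕ, 2 * ∑ i ∈ Finset.range n, (i + 1) = n * (n + 1) := by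
    intro n
    induction n with
    | zero => simp
    | succ n ih => rw [Finset.sum_range_succ, mul_add, ih]; ring
  have := this (p + 1)
  linarith

end
end

section
/- Let p ∈ ℕ and let ε, μ > 0 be real constants. The divergence-free two-dimensional Trefftz space 𝕋̃_p^{2D} = {(E₃, H₁, H₂) ∈ 𝕋_p^{2D} : ∂ₓH₁ + ∂_yH₂ = 0} is a finite-dimensional real vector space and its dimension equals (p+1)(p+3). -/
open MvPolynomial

noncomputable section

/-- The divergence-free two-dimensional Trefftz space
`𝕋̃_p^{2D} = {(E₃,H₁,H₂) ∈ 𝕋_p^{2D} : ∂ₓ H₁ + ∂_y H₂ = 0}`. -/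
def Trefftz2DDivFree (p : ℕ) (ε μ : ℝ) :
    Submodule ℝ (MvPolynomial (Fin 3) ℝ × MvPolynomial (Fin 3) ℝ × MvPolynomial (Fin 3) ℝ) where
  carrier := { u | u ∈ Trefftz2D p ε μ ∧ pderiv 0 u.2.1 + pderiv 1 u.2.2 = 0 }
  add_mem' := by
    rintro a b ⟨ha, ha'⟩ ⟨hb, hb'⟩
    refine ⟨add_mem ha hb, ?_⟩
    show pderiv 0 (a.2.1 + b.2.1) + pderiv 1 (a.2.2 + b.2.2) = 0
    rw [map_add, map_add, show ∀ x y z w : MvPolynomial (Fin 3) ℝ,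
      x + y + (z + w) = (x + z) + (y + w) by intros; ring, ha', hb', add_zero]
  zero_mem' := ⟨zero_mem _, by simp⟩
  smul_mem' := by
    rintro c a ⟨ha, ha'⟩
    refine ⟨Submodule.smul_mem _ c ha, ?_⟩
    show pderiv 0 (c • a.2.1) + pderiv 1 (c • a.2.2) = 0
    rw [Derivation.map_smul, Derivation.map_smul, ← smul_add, ha', smul_zero]

/-- The exponent vector `(i, j, k)`. -/
def tD (i j k : ℕ) : Fin 3 →₀ ℕ := Finsupp.equivFunOnFinite.symm ![i, j, k]

lemma tD_surj (d : Fin 3 →₀ ℕ) : tD (d 0) (d 1) (d 2) = d := by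
  ext n; fin_cases n <;> rfl

lemma tD_add0 (i j k : ℕ) : tD i j k + Finsupp.single 0 1 = tD (i + 1) j k := by
  ext n; fin_cases n <;> simp [tD]

lemma tD_add1 (i j k : ℕ) : tD i j k + Finsupp.single 1 1 = tD i (j + 1) k := by
  ext n; fin_cases n <;> simp [tD]

lemma tD_add2 (i j k : ℕ) : tD i j k + Finsupp.single 2 1 = tD i j (k + 1) := by
  ext n; fin_cases n <;> simp [tD]

/-- Scaled (Taylor) coefficient. -/
def sc (i j k : ℕ) : MvPolynomial (Fin 3) ℝ →ₗ[ℝ] ℝ :=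
  ((i.factorial * j.factorial * k.factorial : ℕ) : ℝ) • MvPolynomial.lcoeff ℝ (tD i j k)

lemma sc_apply (i j k : ℕ) (u : MvPolynomial (Fin 3) ℝ) :
    sc i j k u = ((i.factorial * j.factorial * k.factorial : ℕ) : ℝ) * coeff (tD i j k) u := rfl

lemma fac_ne (i j k : ℕ) : ((i.factorial * j.factorial * k.factorial : ℕ) : ℝ) ≠ 0 := by
  positivity

lemma sc_ext {u v : MvPolynomial (Fin 3) ℝ} (h : ∀ i j k, sc i j k u = sc i j k v) : u = v := by
  ext d
  have := h (d 0) (d 1) (d 2)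
  rw [sc_apply, sc_apply, tD_surj] at this
  exact mul_left_cancel₀ (fac_ne _ _ _) this

lemma sc_pderiv0 (i j k : ℕ) (u : MvPolynomial (Fin 3) ℝ) :
    sc i j k (pderiv 0 u) = sc (i + 1) j k u := by
  rw [sc_apply, sc_apply, coeff_pderiv, tD_add0, Nat.factorial_succ]
  have : (tD i j k) 0 = i := rfl
  rw [this]; push_cast; ring

lemma sc_pderiv1 (i j k : ℕ) (u : MvPolynomial (Fin 3) ℝ) :
    sc i j k (pderiv 1 u) = sc i (j + 1) k u := by
  rw [sc_apply, sc_apply, coeff_pderiv, tD_add1, Nat.factorial_succ]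
  have : (tD i j k) 1 = j := rfl
  rw [this]; push_cast; ring

lemma sc_pderiv2 (i j k : ℕ) (u : MvPolynomial (Fin 3) ℝ) :
    sc i j k (pderiv 2 u) = sc i j (k + 1) u := by
  rw [sc_apply, sc_apply, coeff_pderiv, tD_add2, Nat.factorial_succ]
  have : (tD i j k) 2 = k := rfl
  rw [this]; push_cast; ring

lemma tD_sum (i j k : ℕ) : ((tD i j k).sum fun _ e => e) = i + j + k := by
  rw [Finsupp.sum_fintype _ _ (fun _ => rfl), Fin.sum_univ_three]; rfl

lemma deg_iff (p : ℕ) (u : MvPolynomial (Fin 3) ℝ) :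
    u.totalDegree ≤ p ↔ ∀ i j k, p < i + j + k → sc i j k u = 0 := by
  constructor
  · intro h i j k hp
    by_contra hne
    have hm : tD i j k ∈ u.support := by
      rw [mem_support_iff]
      intro h0
      exact hne (by rw [sc_apply, h0, mul_zero])
    have := le_totalDegree hm
    rw [tD_sum] at this
    omega
  · intro h
    refine Finset.sup_le fun d hd => ?_
    by_contra hlt
    rw [← tD_surj d, tD_sum] at hlt
    have := h _ _ _ (not_le.mp hlt)
    rw [sc_apply, tD_surj] at this
    exact mem_support_iff.mp hd ((mul_eq_zero.mp this).resolve_left (fac_ne _ _ _))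

lemma exists_sc (p : ℕ) (g : ℕ → ℕ → ℕ → ℝ) (hg : ∀ i j k, p < i + j + k → g i j k = 0) :
    ∃ u : MvPolynomial (Fin 3) ℝ, ∀ i j k, sc i j k u = g i j k := by
  classical
  refine ⟨∑ d ∈ Finset.Iic (tD p p p), monomial d
    (g (d 0) (d 1) (d 2) / (((d 0).factorial * (d 1).factorial * (d 2).factorial : ℕ) : ℝ)), ?_⟩
  intro i j k
  rw [sc_apply, coeff_sum]
  simp only [coeff_monomial]
  rw [Finset.sum_ite_eq' (Finset.Iic (tD p p p)) (tD i j k)]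
  split_ifs with h
  · exact mul_div_cancel₀ _ (fac_ne i j k)
  · rw [mul_zero, hg]
    by_contra hlt
    apply h
    rw [Finset.mem_Iic]
    intro n
    fin_cases n
    · show i ≤ p; omega
    · show j ≤ p; omega
    · show k ≤ p; omega

lemma mem_iff (p : ℕ) (ε μ : ℝ)
    (u : MvPolynomial (Fin 3) ℝ × MvPolynomial (Fin 3) ℝ × MvPolynomial (Fin 3) ℝ) :
    u ∈ Trefftz2DDivFree p ε μ ↔
      (∀ i j k, p < i + j + k → sc i j k u.1 = 0) ∧
      (∀ i j k, p < i + j + k → sc i j k u.2.1 = 0) ∧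
      (∀ i j k, p < i + j + k → sc i j k u.2.2 = 0) ∧
      (∀ i j k, ε * sc i j (k + 1) u.1 = sc (i + 1) j k u.2.2 - sc i (j + 1) k u.2.1) ∧
      (∀ i j k, μ * sc i j (k + 1) u.2.1 = - sc i (j + 1) k u.1) ∧
      (∀ i j k, μ * sc i j (k + 1) u.2.2 = sc (i + 1) j k u.1) ∧
      (∀ i j k, sc (i + 1) j k u.2.1 + sc i (j + 1) k u.2.2 = 0) := by
  have key : ∀ v w : MvPolynomial (Fin 3) ℝ, v = w ↔ ∀ i j k, sc i j k v = sc i j k w :=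
    fun v w => ⟨fun h _ _ _ => by rw [h], sc_ext⟩
  change ((u.1.totalDegree ≤ p ∧ u.2.1.totalDegree ≤ p ∧ u.2.2.totalDegree ≤ p ∧
    ε • pderiv 2 u.1 = pderiv 0 u.2.2 - pderiv 1 u.2.1 ∧
    μ • pderiv 2 u.2.1 = - pderiv 1 u.1 ∧
    μ • pderiv 2 u.2.2 = pderiv 0 u.1) ∧ pderiv 0 u.2.1 + pderiv 1 u.2.2 = 0) ↔ _
  rw [deg_iff, deg_iff, deg_iff, key, key, key, key]
  simp only [map_smul, map_sub, map_neg, map_add, map_zero, sc_pderiv0, sc_pderiv1, sc_pderiv2,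
    smul_eq_mul, and_assoc]

/-- The potential: solution of the wave equation in Taylor coefficients. -/
def pot (c : ℝ) (W0 W1 : ℕ → ℕ → ℝ) : ℕ → ℕ → ℕ → ℝ
  | 0 => W0
  | 1 => W1
  | (k + 2) => fun i j => (pot c W0 W1 k (i + 2) j + pot c W0 W1 k i (j + 2)) / c

lemma pot_zero (q : ℕ) (c : ℝ) (W0 W1 : ℕ → ℕ → ℝ) (h0 : ∀ i j, q < i + j → W0 i j = 0)
    (h1 : ∀ i j, q < i + j + 1 → W1 i j = 0) :
    ∀ k i j, q < i + j + k → pot c W0 W1 k i j = 0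
  | 0, i, j, h => h0 i j h
  | 1, i, j, h => h1 i j h
  | (k + 2), i, j, h => by
    have a := pot_zero q c W0 W1 h0 h1 k (i + 2) j (by omega)
    have b := pot_zero q c W0 W1 h0 h1 k i (j + 2) (by omega)
    simp [pot, a, b]

/-- The indices `(i, j)` with `i + j ≤ p`. -/
abbrev tT (p : ℕ) : Finset (Σ _ : ℕ, ℕ) :=
  (Finset.range (p + 1)).sigma (fun i => Finset.range (p + 1 - i))

lemma mem_tT (p : ℕ) (i j : ℕ) : (⟨i, j⟩ : Σ _ : ℕ, ℕ) ∈ tT p ↔ i + j ≤ p := by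
  simp only [tT, Finset.mem_sigma, Finset.mem_range]
  omega

lemma card_tT (p : ℕ) : (tT p).card * 2 = (p + 1) * (p + 2) := by
  simp only [tT, Finset.card_sigma, Finset.card_range]
  have h : ∑ i ∈ Finset.range (p + 1), (p + 1 - i) = ∑ i ∈ Finset.range (p + 1), (i + 1) := by
    rw [← Finset.sum_range_reflect]
    refine Finset.sum_congr rfl fun i hi => ?_
    rw [Finset.mem_range] at hi
    omega
  rw [h]
  clear h
  induction p with
  | zero => simp
  | succ n ih => rw [Finset.sum_range_succ, add_mul, ih]; ring

/-- The free Taylor coefficients of the initial data. -/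
def tPhi (p : ℕ) : (MvPolynomial (Fin 3) ℝ × MvPolynomial (Fin 3) ℝ × MvPolynomial (Fin 3) ℝ)
    →ₗ[ℝ] ((tT p → ℝ) × (tT p → ℝ) × (Fin (p + 1) → ℝ)) where
  toFun u := (fun s => sc s.1.1 s.1.2 0 u.1, fun s => sc s.1.1 s.1.2 0 u.2.2,
    fun j => sc 0 j 0 u.2.1)
  map_add' u v := by
    refine Prod.ext ?_ (Prod.ext ?_ ?_) <;> funext s <;> simp
  map_smul' r u := by
    refine Prod.ext ?_ (Prod.ext ?_ ?_) <;> funext s <;> simp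

lemma tPhi_inj (p : ℕ) (ε μ : ℝ) (hε : 0 < ε) (hμ : 0 < μ)
    (u : MvPolynomial (Fin 3) ℝ × MvPolynomial (Fin 3) ℝ × MvPolynomial (Fin 3) ℝ)
    (hu : u ∈ Trefftz2DDivFree p ε μ) (h : tPhi p u = 0) : u = 0 := by
  obtain ⟨d1, d2, d3, e1, e2, e3, e4⟩ := (mem_iff p ε μ u).1 hu
  have hE : ∀ i j, sc i j 0 u.1 = 0 := by
    intro i j
    by_cases hij : i + j ≤ p
    · exact congrFun (congrArg Prod.fst h) ⟨⟨i, j⟩, (mem_tT p i j).2 hij⟩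
    · exact d1 i j 0 (by omega)
  have hB : ∀ i j, sc i j 0 u.2.2 = 0 := by
    intro i j
    by_cases hij : i + j ≤ p
    · exact congrFun (congrArg (fun x => x.2.1) h) ⟨⟨i, j⟩, (mem_tT p i j).2 hij⟩
    · exact d3 i j 0 (by omega)
  have hA : ∀ i j, sc i j 0 u.2.1 = 0 := by
    intro i j
    cases i with
    | zero =>
      by_cases hij : j < p + 1
      · exact congrFun (congrArg (fun x => x.2.2) h) ⟨j, hij⟩
      · exact d2 0 j 0 (by omega)
    | succ i =>
      have := e4 i j 0
      rw [hB, add_zero] at this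
      exact this
  have all : ∀ k, (∀ i j, sc i j k u.1 = 0) ∧ (∀ i j, sc i j k u.2.1 = 0) ∧
      (∀ i j, sc i j k u.2.2 = 0) := by
    intro k
    induction k with
    | zero => exact ⟨hE, hA, hB⟩
    | succ k ih =>
      obtain ⟨i1, i2, i3⟩ := ih
      refine ⟨fun i j => ?_, fun i j => ?_, fun i j => ?_⟩
      · have := e1 i j k
        rw [i2, i3, sub_zero] at this
        exact (mul_eq_zero.mp this).resolve_left hε.ne'
      · have := e2 i j k
        rw [i1, neg_zero] at this
        exact (mul_eq_zero.mp this).resolve_left hμ.ne'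
      · have := e3 i j k
        rw [i1] at this
        exact (mul_eq_zero.mp this).resolve_left hμ.ne'
  refine Prod.ext ?_ (Prod.ext ?_ ?_) <;> refine sc_ext fun i j k => ?_
  · simpa using (all k).1 i j
  · simpa using (all k).2.1 i j
  · simpa using (all k).2.2 i j

lemma tPhi_surj (p : ℕ) (ε μ : ℝ) (hε : 0 < ε) (hμ : 0 < μ)
    (f : (tT p → ℝ) × (tT p → ℝ) × (Fin (p + 1) → ℝ)) :
    ∃ u ∈ Trefftz2DDivFree p ε μ, tPhi p u = f := by
  classical
  obtain ⟨fE, fB, fA⟩ := f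
  let gE : ℕ → ℕ → ℝ := fun i j =>
    if h : (⟨i, j⟩ : Σ _ : ℕ, ℕ) ∈ tT p then fE ⟨⟨i, j⟩, h⟩ else 0
  let gB : ℕ → ℕ → ℝ := fun i j =>
    if h : (⟨i, j⟩ : Σ _ : ℕ, ℕ) ∈ tT p then fB ⟨⟨i, j⟩, h⟩ else 0
  let gA : ℕ → ℝ := fun j => if h : j < p + 1 then fA ⟨j, h⟩ else 0
  let W0 : ℕ → ℕ → ℝ := fun i j =>
    match i, j with
    | 0, 0 => 0
    | 0, j + 1 => - gA j
    | i + 1, j => gB i j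
  let W1 : ℕ → ℕ → ℝ := fun i j => gE i j / μ
  have gE0 : ∀ i j, p < i + j → gE i j = 0 := fun i j h =>
    dif_neg (by rw [mem_tT]; omega)
  have gB0 : ∀ i j, p < i + j → gB i j = 0 := fun i j h =>
    dif_neg (by rw [mem_tT]; omega)
  have gA0 : ∀ j, p < j → gA j = 0 := fun j h => dif_neg (by omega)
  have hW0 : ∀ i j, p + 1 < i + j → W0 i j = 0 := by
    intro i j h
    match i, j with
    | 0, 0 => rfl
    | 0, j + 1 => show - gA j = 0; rw [gA0 j (by omega), neg_zero]
    | i + 1, j => exact gB0 i j (by omega)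
  have hW1 : ∀ i j, p + 1 < i + j + 1 → W1 i j = 0 := by
    intro i j h
    show gE i j / μ = 0
    rw [gE0 i j (by omega), zero_div]
  have hz := pot_zero (p + 1) (ε * μ) W0 W1 hW0 hW1
  obtain ⟨uE, hE⟩ := exists_sc p (fun i j k => μ * pot (ε * μ) W0 W1 (k + 1) i j)
    (fun i j k h => by simp [hz (k + 1) i j (by omega)])
  obtain ⟨uA, hA⟩ := exists_sc p (fun i j k => - pot (ε * μ) W0 W1 k i (j + 1))
    (fun i j k h => by simp [hz k i (j + 1) (by omega)])
  obtain ⟨uB, hB⟩ := exists_sc p (fun i j k => pot (ε * μ) W0 W1 k (i + 1) j)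
    (fun i j k h => by simp [hz k (i + 1) j (by omega)])
  refine ⟨(uE, uA, uB), (mem_iff p ε μ _).2 ⟨?_, ?_, ?_, ?_, ?_, ?_, ?_⟩, ?_⟩
  · intro i j k h
    rw [hE, hz (k + 1) i j (by omega), mul_zero]
  · intro i j k h
    rw [hA, hz k i (j + 1) (by omega), neg_zero]
  · intro i j k h
    rw [hB, hz k (i + 1) j (by omega)]
  · intro i j k
    simp only [hE, hA, hB]
    simp only [pot]
    field_simp
    ring
  · intro i j k
    simp only [hE, hA]
    ring
  · intro i j k
    simp only [hE, hB]
  · intro i j k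
    simp only [hA, hB]
    ring
  · refine Prod.ext ?_ (Prod.ext ?_ ?_)
    · funext s
      show sc s.1.1 s.1.2 0 uE = fE s
      rw [hE]
      show μ * (gE s.1.1 s.1.2 / μ) = fE s
      rw [mul_div_cancel₀ _ hμ.ne']
      exact dif_pos s.2
    · funext s
      show sc s.1.1 s.1.2 0 uB = fB s
      rw [hB]
      show gB s.1.1 s.1.2 = fB s
      exact dif_pos s.2
    · funext s
      show sc 0 s 0 uA = fA s
      rw [hA]
      show - - gA s = fA s
      rw [neg_neg]
      exact dif_pos s.2

/-- The divergence-free two-dimensional Trefftz space `𝕋̃_p^{2D}` is finite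
dimensional of dimension `(p+1)(p+3)`. -/
theorem trefftz2D_div_free_finrank (p : ℕ) (ε μ : ℝ) (hε : 0 < ε) (hμ : 0 < μ) :
    FiniteDimensional ℝ (Trefftz2DDivFree p ε μ) ∧
      Module.finrank ℝ (Trefftz2DDivFree p ε μ) = (p + 1) * (p + 3) := by
  let L := (tPhi p).comp (Trefftz2DDivFree p ε μ).subtype
  have hinj : Function.Injective L := by
    rw [← LinearMap.ker_eq_bot, LinearMap.ker_eq_bot']
    intro u hu
    exact Subtype.ext (tPhi_inj p ε μ hε hμ u.1 u.2 hu)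
  have hsurj : Function.Surjective L := by
    intro f
    obtain ⟨u, hu, h⟩ := tPhi_surj p ε μ hε hμ f
    exact ⟨⟨u, hu⟩, h⟩
  let e := LinearEquiv.ofBijective L ⟨hinj, hsurj⟩
  refine ⟨Module.Finite.equiv e.symm, ?_⟩
  rw [e.finrank_eq, Module.finrank_prod, Module.finrank_prod, Module.finrank_pi,
    Module.finrank_pi, Fintype.card_coe, Fintype.card_fin]
  have := card_tT p
  nlinarith

end
end

section
/- Let p ∈ ℕ, let ε, μ > 0 be real constants, let K = [a₁,b₁] × [a₂,b₂] × [a₃,b₃] ⊂ ℝ³ be a closed box with aᵢ < bᵢ for all i, and let t₀ ∈ ℝ. Then there exists a constant c > 0 such that for every pair (E, H) in the Trefftz space 𝕋_p and every t ∈ ℝ, one has ∫_K (ε·|E(x,t)|² + μ·|H(x,t)|²) dx ≤ exp(c·|t − t₀|) · ∫_K (ε·|E(x,t₀)|² + μ·|H(x,t₀)|²) dx, where E(x,t) ∈ ℝ³ and H(x,t) ∈ ℝ³ denote the componentwise evaluations of the polynomial triples at (x,t), |·| is the Euclidean norm on ℝ³, and the integrals are taken with respect to Lebesgue measure on ℝ³.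 -/
open MvPolynomial

noncomputable section

open MeasureTheory

/-- The electromagnetic energy density `ε|E(x,t)|² + μ|H(x,t)|²` obtained by evaluating
the polynomial fields at the point `(x, t) ∈ ℝ³ × ℝ`. -/
def energyDensity (ε μ : ℝ) (E H : Fin 3 → MvPolynomial (Fin 4) ℝ)
    (x : Fin 3 → ℝ) (t : ℝ) : ℝ :=
  ε * ∑ i, (eval (Fin.snoc x t) (E i)) ^ 2 + μ * ∑ i, (eval (Fin.snoc x t) (H i)) ^ 2

/-- Evaluation of a polynomial on a box is integrable. -/
lemma integrableOn_evalBox (a b : Fin 3 → ℝ) {g : (Fin 3 → ℝ) → ℝ} (hg : Continuous g) :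
    IntegrableOn g (Set.Icc a b) :=
  hg.continuousOn.integrableOn_compact isCompact_Icc

/-- The `L²(K)` inner product on polynomials in the spatial variables. -/
@[reducible]
def boxCore (a b : Fin 3 → ℝ) (hab : ∀ i, a i < b i) :
    InnerProductSpace.Core ℝ (MvPolynomial (Fin 3) ℝ) where
  inner f g := ∫ x in Set.Icc a b, eval x f * eval x g
  conj_inner_symm f g := by
    simp only [conj_trivial]
    exact integral_congr_ae (Filter.Eventually.of_forall fun x => mul_comm _ _)
  re_inner_nonneg f := by
    simp only [RCLike.re_to_real]
    exact integral_nonneg fun x => mul_self_nonneg _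
  add_left f g h := by
    rw [← integral_add]
    · exact integral_congr_ae (Filter.Eventually.of_forall fun x => by simp [add_mul])
    · exact integrableOn_evalBox a b ((continuous_eval f).mul (continuous_eval h))
    · exact integrableOn_evalBox a b ((continuous_eval g).mul (continuous_eval h))
  smul_left f g r := by
    simp only [conj_trivial]
    rw [← integral_const_mul]
    exact integral_congr_ae (Filter.Eventually.of_forall fun x => by
      simp [smul_eval, mul_assoc])
  definite f hf := by
    have hc : Continuous fun x : Fin 3 → ℝ => eval x f * eval x f :=
      (continuous_eval f).mul (continuous_eval f)
    have h0 := (setIntegral_eq_zero_iff_of_nonneg_ae (μ := volume)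
      (Filter.Eventually.of_forall fun x : Fin 3 → ℝ => mul_self_nonneg (eval x f))
      (integrableOn_evalBox a b hc)).1 hf
    have hs : Set.pi Set.univ (fun i => Set.Ioo (a i) (b i)) ⊆ Set.Icc a b := by
      intro x hx
      exact ⟨fun i => (hx i trivial).1.le, fun i => (hx i trivial).2.le⟩
    have h1 := Measure.eqOn_open_of_ae_eq (ae_restrict_of_ae_restrict_of_subset hs h0)
      (isOpen_set_pi Set.finite_univ fun i _ => isOpen_Ioo) hc.continuousOn continuousOn_const
    refine funext_set (fun i => Set.Ioo (a i) (b i)) (fun i => Set.Ioo_infinite (hab i)) ?_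
    intro x hx
    have := h1 hx
    simpa using this

/-- A linear map on a finite-dimensional subspace is bounded for an inner product. -/
lemma exists_bound_of_core {V : Type*} [AddCommGroup V] [Module ℝ V]
    (core : InnerProductSpace.Core ℝ V) (S : Submodule ℝ V) [FiniteDimensional ℝ S]
    (L : V →ₗ[ℝ] V) :
    ∃ C : ℝ, 0 ≤ C ∧ ∀ f ∈ S, core.inner (L f) (L f) ≤ C * core.inner f f := by
  letI : NormedAddCommGroup V := core.toNormedAddCommGroup
  letI : InnerProductSpace ℝ V := InnerProductSpace.ofCore core.toCore
  have hn : ∀ f : V, core.inner f f = ‖f‖ ^ 2 := fun f => real_inner_self_eq_norm_sq f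
  let D : S →ₗ[ℝ] V := L ∘ₗ S.subtype
  let D' : S →L[ℝ] V := LinearMap.toContinuousLinearMap D
  refine ⟨‖D'‖ ^ 2, sq_nonneg _, fun f hf => ?_⟩
  rw [hn, hn, ← mul_pow]
  have := D'.le_opNorm ⟨f, hf⟩
  exact pow_le_pow_left₀ (norm_nonneg _) this 2

/-- Inverse estimate for spatial polynomials of bounded degree. -/
lemma inverse_estimate (p : ℕ) (a b : Fin 3 → ℝ) (hab : ∀ i, a i < b i) (i : Fin 3) :
    ∃ C : ℝ, 0 ≤ C ∧ ∀ f : MvPolynomial (Fin 3) ℝ, f.totalDegree ≤ p →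
      ∫ x in Set.Icc a b, (eval x (pderiv i f)) ^ 2 ≤
        C * ∫ x in Set.Icc a b, (eval x f) ^ 2 := by
  obtain ⟨C, hC, h⟩ := exists_bound_of_core (boxCore a b hab)
    (restrictTotalDegree (Fin 3) ℝ p) (pderiv i).toLinearMap
  refine ⟨C, hC, fun f hf => ?_⟩
  have := h f ((mem_restrictTotalDegree _ _ _).2 hf)
  simp_rw [sq]
  exact this

lemma snoc_three {α : Type*} (x : Fin 3 → α) (t : α) : (Fin.snoc x t : Fin 4 → α) 3 = t :=
  Fin.snoc_last (α := fun _ => α) t x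

/-- Freezing time. -/
def timeSlice (t : ℝ) : MvPolynomial (Fin 4) ℝ →ₐ[ℝ] MvPolynomial (Fin 3) ℝ :=
  aeval (Fin.snoc (α := fun _ => MvPolynomial (Fin 3) ℝ) X (C t))

lemma eval_timeSlice (t : ℝ) (x : Fin 3 → ℝ) (f : MvPolynomial (Fin 4) ℝ) :
    eval x (timeSlice t f) = eval (Fin.snoc x t) f := by
  induction f using MvPolynomial.induction_on with
  | C r => simp [timeSlice]
  | add f g hf hg => simp [hf, hg]
  | mul_X f i hf =>
    rw [map_mul, map_mul, map_mul, hf]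
    congr 1
    refine Fin.lastCases ?_ (fun j => ?_) i <;> simp [timeSlice, snoc_three]

lemma pderiv_timeSlice (t : ℝ) (i : Fin 3) (f : MvPolynomial (Fin 4) ℝ) :
    pderiv i (timeSlice t f) = timeSlice t (pderiv i.castSucc f) := by
  induction f using MvPolynomial.induction_on with
  | C r => simp [timeSlice]
  | add f g hf hg => simp [hf, hg]
  | mul_X f j hf =>
    rw [map_mul, Derivation.leibniz, Derivation.leibniz, hf]
    simp only [smul_eq_mul, map_add, map_mul]
    congr 2
    refine Fin.lastCases ?_ (fun k => ?_) j
    · have : (Fin.last 3) ≠ i.castSucc := (Fin.castSucc_lt_last i).ne'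
      rw [pderiv_X_of_ne this]
      simp [timeSlice, snoc_three]
    · by_cases h : k = i
      · subst h; simp [timeSlice]
      · have h' : k.castSucc ≠ i.castSucc := fun e => h (Fin.castSucc_injective _ e)
        rw [pderiv_X_of_ne h']
        simp [timeSlice, pderiv_X_of_ne h]

lemma totalDegree_timeSlice (t : ℝ) (f : MvPolynomial (Fin 4) ℝ) :
    (timeSlice t f).totalDegree ≤ f.totalDegree := by
  conv_lhs => rw [f.as_sum, map_sum]
  refine totalDegree_finsetSum_le fun s hs => ?_
  refine le_trans ?_ (le_totalDegree hs)
  rw [timeSlice, aeval_monomial]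
  refine (totalDegree_mul _ _).trans ?_
  rw [algebraMap_eq, totalDegree_C, zero_add, Finsupp.prod, Finsupp.sum]
  refine (totalDegree_finsetProd _ _).trans (Finset.sum_le_sum fun j _ => ?_)
  refine (totalDegree_pow _ _).trans ?_
  have : (Fin.snoc (α := fun _ => MvPolynomial (Fin 3) ℝ) X (C t) j).totalDegree ≤ 1 := by
    refine Fin.lastCases ?_ (fun k => ?_) j <;> simp [snoc_three]
  nlinarith

lemma continuous_evalSnoc (t : ℝ) (f : MvPolynomial (Fin 4) ℝ) :
    Continuous fun x : Fin 3 → ℝ => eval (Fin.snoc x t : Fin 4 → ℝ) f := by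
  simp_rw [← eval_timeSlice]
  exact continuous_eval _

/-- Inverse estimate, uniformly in time and the direction. -/
lemma inverse_estimate_time (p : ℕ) (a b : Fin 3 → ℝ) (hab : ∀ i, a i < b i) :
    ∃ C : ℝ, 0 ≤ C ∧ ∀ (i : Fin 3) (t : ℝ) (f : MvPolynomial (Fin 4) ℝ), f.totalDegree ≤ p →
      ∫ x in Set.Icc a b, (eval (Fin.snoc x t : Fin 4 → ℝ) (pderiv i.castSucc f)) ^ 2 ≤
        C * ∫ x in Set.Icc a b, (eval (Fin.snoc x t : Fin 4 → ℝ) f) ^ 2 := by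
  choose C hC h using inverse_estimate p a b hab
  refine ⟨∑ i, C i, Finset.sum_nonneg fun i _ => hC i, fun i t f hf => ?_⟩
  have h1 := h i (timeSlice t f) ((totalDegree_timeSlice t f).trans hf)
  simp_rw [pderiv_timeSlice, eval_timeSlice] at h1
  refine h1.trans (mul_le_mul_of_nonneg_right ?_ (integral_nonneg fun x => sq_nonneg _))
  exact Finset.single_le_sum (fun i _ => hC i) (Finset.mem_univ i)

/-- Differentiation under the integral for polynomials. -/
lemma hasDerivAt_integral_poly (a b : Fin 3 → ℝ) (g : MvPolynomial (Fin 4) ℝ) (t : ℝ) :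
    HasDerivAt (fun t => ∫ x in Set.Icc a b, eval (Fin.snoc x t : Fin 4 → ℝ) g)
      (∫ x in Set.Icc a b, eval (Fin.snoc x t : Fin 4 → ℝ) (pderiv 3 g)) t := by
  induction g using MvPolynomial.induction_on' with
  | monomial s r =>
    have e1 : ∀ (x : Fin 3 → ℝ) (t : ℝ), eval (Fin.snoc x t : Fin 4 → ℝ) (monomial s r) =
        (r * ∏ i : Fin 3, x i ^ s i.castSucc) * t ^ s 3 := by
      intro x t
      rw [eval_monomial, Finsupp.prod_fintype _ _ (by simp), Fin.prod_univ_castSucc]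
      simp [mul_assoc, snoc_three]
    have e2 : ∀ (x : Fin 3 → ℝ) (t : ℝ),
        eval (Fin.snoc x t : Fin 4 → ℝ) (pderiv 3 (monomial s r)) =
        (r * ∏ i : Fin 3, x i ^ s i.castSucc) * (s 3 * t ^ (s 3 - 1)) := by
      intro x t
      rw [pderiv_monomial, eval_monomial, Finsupp.prod_fintype _ _ (by simp),
        Fin.prod_univ_castSucc]
      have : ∀ i : Fin 3, (3 : Fin 4) ≠ i.castSucc := fun i => (Fin.castSucc_lt_last i).ne'
      have h3 : (Fin.last 3 : Fin 4) = 3 := rfl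
      simp [Finsupp.single_apply, this, h3]
      have h4 : (Fin.snoc x t : Fin 4 → ℝ) 3 = t := Fin.snoc_last (α := fun _ => ℝ) t x
      try rw [h4]
      ring
    simp_rw [e1, e2, integral_mul_const]
    exact (hasDerivAt_pow _ _).const_mul _
  | add f g hf hg =>
    have := hf.add hg
    simp_rw [map_add]
    rw [integral_add (integrableOn_evalBox a b (continuous_evalSnoc t _))
      (integrableOn_evalBox a b (continuous_evalSnoc t _))]
    refine this.congr_of_eventuallyEq (Filter.Eventually.of_forall fun t => ?_)
    exact integral_add (integrableOn_evalBox a b (continuous_evalSnoc t _))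
      (integrableOn_evalBox a b (continuous_evalSnoc t _))

/-- Two-sided scalar Gronwall inequality. -/
lemma scalar_gronwall {W W' : ℝ → ℝ} {c : ℝ} (hW : ∀ t, HasDerivAt W (W' t) t)
    (hb : ∀ t, |W' t| ≤ c * W t) (t₀ t : ℝ) :
    W t ≤ Real.exp (c * |t - t₀|) * W t₀ := by
  have hd : ∀ k t : ℝ, HasDerivAt (fun t => Real.exp (k * t) * W t)
      (Real.exp (k * t) * (k * W t + W' t)) t := by
    intro k t
    have h1 : HasDerivAt (fun t : ℝ => Real.exp (k * t)) (Real.exp (k * t) * k) t := by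
      simpa using ((hasDerivAt_id t).const_mul k).exp
    exact (h1.mul (hW t)).congr_deriv (by ring)
  rcases le_total t₀ t with h | h
  · have := antitone_of_hasDerivAt_nonpos (hd (-c)) (fun t =>
      mul_nonpos_of_nonneg_of_nonpos (Real.exp_pos _).le (by linarith [(abs_le.1 (hb t)).2])) h
    rw [abs_of_nonneg (by linarith)]
    have h2 := mul_le_mul_of_nonneg_left this (Real.exp_pos (c * t)).le
    simp only [← mul_assoc, ← Real.exp_add] at h2
    rw [show c * t + -c * t = 0 by ring, Real.exp_zero, one_mul] at h2
    rwa [show c * t + -c * t₀ = c * (t - t₀) by ring] at h2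
  · have := monotone_of_hasDerivAt_nonneg (hd c) (fun t =>
      mul_nonneg (Real.exp_pos _).le (by linarith [(abs_le.1 (hb t)).1])) h
    rw [abs_of_nonpos (by linarith)]
    have h2 := mul_le_mul_of_nonneg_left this (Real.exp_pos (-(c * t))).le
    simp only [← mul_assoc, ← Real.exp_add] at h2
    rw [show -(c * t) + c * t = 0 by ring, Real.exp_zero, one_mul] at h2
    rwa [show -(c * t) + c * t₀ = c * -(t - t₀) by ring] at h2

/-- The polynomial whose values are the energy density. -/
def energyPoly (ε μ : ℝ) (E H : Fin 3 → MvPolynomial (Fin 4) ℝ) : MvPolynomial (Fin 4) ℝ :=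
  C ε * ∑ i, (E i) ^ 2 + C μ * ∑ i, (H i) ^ 2

lemma eval_energyPoly (ε μ : ℝ) (E H : Fin 3 → MvPolynomial (Fin 4) ℝ)
    (x : Fin 3 → ℝ) (t : ℝ) :
    eval (Fin.snoc x t : Fin 4 → ℝ) (energyPoly ε μ E H) = energyDensity ε μ E H x t := by
  simp [energyPoly, energyDensity]

lemma pderiv_energyPoly (ε μ : ℝ) (E H : Fin 3 → MvPolynomial (Fin 4) ℝ)
    (hE : ∀ i, ε • pderiv 3 (E i) = curl4 H i) (hH : ∀ i, μ • pderiv 3 (H i) = - curl4 E i) :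
    pderiv 3 (energyPoly ε μ E H) = ∑ i, (2 * E i * curl4 H i - 2 * H i * curl4 E i) := by
  have h1 : ∀ i, curl4 H i = C ε * pderiv 3 (E i) := fun i => by
    rw [← hE, smul_eq_C_mul]
  have h2 : ∀ i, curl4 E i = - (C μ * pderiv 3 (H i)) := fun i => by
    rw [← smul_eq_C_mul, hH, neg_neg]
  simp only [energyPoly, map_add, Derivation.leibniz, pderiv_C, smul_zero, add_zero, map_sum,
    Derivation.leibniz_pow, smul_eq_mul, Fin.sum_univ_three, h1, h2]
  simp
  ring

/-- Grönwall-type stability for Trefftz polynomials: the energy over the box `K` at any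
time `t` is bounded by `exp(c|t - t₀|)` times the energy at time `t₀`. -/
theorem trefftz_gronwall_stability (p : ℕ) (ε μ : ℝ) (hε : 0 < ε) (hμ : 0 < μ)
    (a b : Fin 3 → ℝ) (hab : ∀ i, a i < b i) (t₀ : ℝ) :
    ∃ c > 0, ∀ EH ∈ TrefftzSpace p ε μ, ∀ t : ℝ,
      (∫ x in Set.Icc a b, energyDensity ε μ EH.1 EH.2 x t) ≤
        Real.exp (c * |t - t₀|) * ∫ x in Set.Icc a b, energyDensity ε μ EH.1 EH.2 x t₀ := by
  obtain ⟨C, hC, hinv⟩ := inverse_estimate_time p a b hab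
  have hm : 0 < min ε μ := lt_min hε hμ
  refine ⟨(1 + 6 * C) / min ε μ, by positivity, ?_⟩
  rintro ⟨E, H⟩ ⟨hdE, hdH, hE, hH⟩ t
  dsimp only at hdE hdH hE hH ⊢
  let N : MvPolynomial (Fin 4) ℝ → ℝ → ℝ := fun f t =>
    ∫ x in Set.Icc a b, (eval (Fin.snoc x t : Fin 4 → ℝ) f) ^ 2
  have hN0 : ∀ f t, 0 ≤ N f t := fun f t => integral_nonneg fun x => sq_nonneg _
  have hI : ∀ f t, IntegrableOn (fun x => (eval (Fin.snoc x t : Fin 4 → ℝ) f) ^ 2)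
      (Set.Icc a b) := fun f t => integrableOn_evalBox a b ((continuous_evalSnoc t f).pow 2)
  have hEs : ∀ t, ∫ x in Set.Icc a b, energyDensity ε μ E H x t =
      ε * ∑ i, N (E i) t + μ * ∑ i, N (H i) t := by
    intro t
    simp only [energyDensity]
    rw [integral_add, integral_const_mul, integral_const_mul, integral_finsetSum,
      integral_finsetSum]
    · exact fun i _ => hI _ t
    · exact fun i _ => hI _ t
    · exact (integrable_finsetSum _ fun i _ => hI _ t).const_mul _
    · exact (integrable_finsetSum _ fun i _ => hI _ t).const_mul _
  have hder : ∀ t, HasDerivAt (fun t => ∫ x in Set.Icc a b, energyDensity ε μ E H x t)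
      (∫ x in Set.Icc a b, eval (Fin.snoc x t : Fin 4 → ℝ) (pderiv 3 (energyPoly ε μ E H))) t := by
    intro t
    have := hasDerivAt_integral_poly a b (energyPoly ε μ E H) t
    simpa only [eval_energyPoly] using this
  refine scalar_gronwall hder (fun t => ?_) t₀ t
  rw [pderiv_energyPoly ε μ E H hE hH]
  have hpt : ∀ x : Fin 3 → ℝ,
      |eval (Fin.snoc x t : Fin 4 → ℝ) (∑ i, (2 * E i * curl4 H i - 2 * H i * curl4 E i))| ≤
      ∑ j, ((eval (Fin.snoc x t : Fin 4 → ℝ) (E j)) ^ 2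
          + (eval (Fin.snoc x t : Fin 4 → ℝ) (H j)) ^ 2
        + 2 * ∑ i : Fin 3, ((eval (Fin.snoc x t : Fin 4 → ℝ) (pderiv i.castSucc (E j))) ^ 2
          + (eval (Fin.snoc x t : Fin 4 → ℝ) (pderiv i.castSucc (H j))) ^ 2)) := by
    intro x
    have key : ∀ u v d e : ℝ, |2 * u * (d - e)| ≤ u ^ 2 + 2 * d ^ 2 + 2 * e ^ 2 := by
      intro u v d e
      rw [abs_le]
      constructor <;> nlinarith [sq_nonneg (u + (d - e)), sq_nonneg (u - (d - e)),
        sq_nonneg (d + e)]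
    have c0 : Fin.castSucc (0 : Fin 3) = 0 := rfl
    have c1 : Fin.castSucc (1 : Fin 3) = 1 := rfl
    have c2 : Fin.castSucc (2 : Fin 3) = 2 := rfl
    set y : Fin 4 → ℝ := Fin.snoc x t
    simp only [Fin.sum_univ_three, c0, c1, c2, curl4, Matrix.cons_val_zero, Matrix.cons_val_one,
      Matrix.cons_val, map_add, map_sub, map_mul, map_ofNat]
    have k1 := abs_le.1 (key (eval y (E 0)) 0 (eval y (pderiv 1 (H 2))) (eval y (pderiv 2 (H 1))))
    have k2 := abs_le.1 (key (eval y (E 1)) 0 (eval y (pderiv 2 (H 0))) (eval y (pderiv 0 (H 2))))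
    have k3 := abs_le.1 (key (eval y (E 2)) 0 (eval y (pderiv 0 (H 1))) (eval y (pderiv 1 (H 0))))
    have k4 := abs_le.1 (key (eval y (H 0)) 0 (eval y (pderiv 1 (E 2))) (eval y (pderiv 2 (E 1))))
    have k5 := abs_le.1 (key (eval y (H 1)) 0 (eval y (pderiv 2 (E 0))) (eval y (pderiv 0 (E 2))))
    have k6 := abs_le.1 (key (eval y (H 2)) 0 (eval y (pderiv 0 (E 1))) (eval y (pderiv 1 (E 0))))
    have s1 := sq_nonneg (eval y (pderiv 0 (E 0)))
    have s2 := sq_nonneg (eval y (pderiv 1 (E 1)))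
    have s3 := sq_nonneg (eval y (pderiv 2 (E 2)))
    have s4 := sq_nonneg (eval y (pderiv 0 (H 0)))
    have s5 := sq_nonneg (eval y (pderiv 1 (H 1)))
    have s6 := sq_nonneg (eval y (pderiv 2 (H 2)))
    rw [abs_le]
    constructor <;>
      linarith only [k1.1, k1.2, k2.1, k2.2, k3.1, k3.2, k4.1, k4.2, k5.1, k5.2, k6.1, k6.2,
        s1, s2, s3, s4, s5, s6]
  have hJ : ∀ j, IntegrableOn (fun x : Fin 3 → ℝ =>
        2 * ∑ i : Fin 3, ((eval (Fin.snoc x t : Fin 4 → ℝ) (pderiv i.castSucc (E j))) ^ 2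
          + (eval (Fin.snoc x t : Fin 4 → ℝ) (pderiv i.castSucc (H j))) ^ 2)) (Set.Icc a b) :=
    fun j => (integrable_finsetSum _ fun i _ => (hI _ t).add (hI _ t)).const_mul _
  have hint : ∫ x in Set.Icc a b, ∑ j, ((eval (Fin.snoc x t : Fin 4 → ℝ) (E j)) ^ 2
          + (eval (Fin.snoc x t : Fin 4 → ℝ) (H j)) ^ 2
        + 2 * ∑ i : Fin 3, ((eval (Fin.snoc x t : Fin 4 → ℝ) (pderiv i.castSucc (E j))) ^ 2
          + (eval (Fin.snoc x t : Fin 4 → ℝ) (pderiv i.castSucc (H j))) ^ 2)) =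
      ∑ j, (N (E j) t + N (H j) t + 2 * ∑ i : Fin 3,
        (N (pderiv i.castSucc (E j)) t + N (pderiv i.castSucc (H j)) t)) := by
    rw [integral_finsetSum]
    swap
    · exact fun j _ => ((hI _ t).add (hI _ t)).add (hJ j)
    refine Finset.sum_congr rfl fun j _ => ?_
    rw [integral_add _ (hJ j), integral_add (hI _ t) (hI _ t),
      integral_const_mul, integral_finsetSum]
    rotate_left
    · exact fun i _ => (hI _ t).add (hI _ t)
    · exact (hI _ t).add (hI _ t)
    congr 2
    exact Finset.sum_congr rfl fun i _ => integral_add (hI _ t) (hI _ t)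
  have hGint := integrable_finsetSum Finset.univ fun j (_ : j ∈ Finset.univ) =>
    ((hI (E j) t).add (hI (H j) t)).add (hJ j)
  have hle : |∫ x in Set.Icc a b, eval (Fin.snoc x t : Fin 4 → ℝ)
      (∑ i, (2 * E i * curl4 H i - 2 * H i * curl4 E i))| ≤
      ∑ j, (N (E j) t + N (H j) t + 2 * ∑ i : Fin 3,
        (N (pderiv i.castSucc (E j)) t + N (pderiv i.castSucc (H j)) t)) := by
    rw [← hint]
    refine abs_integral_le_integral_abs.trans ?_
    exact integral_mono (integrableOn_evalBox a b (continuous_evalSnoc t _).abs) hGint hpt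
  have hsum : ∑ j, (N (E j) t + N (H j) t + 2 * ∑ i : Fin 3,
        (N (pderiv i.castSucc (E j)) t + N (pderiv i.castSucc (H j)) t)) ≤
      (1 + 6 * C) * (∑ j, N (E j) t + ∑ j, N (H j) t) := by
    rw [← Finset.sum_add_distrib, Finset.mul_sum]
    refine Finset.sum_le_sum fun j _ => ?_
    have : ∑ i : Fin 3, (N (pderiv i.castSucc (E j)) t + N (pderiv i.castSucc (H j)) t) ≤
        ∑ _i : Fin 3, (C * N (E j) t + C * N (H j) t) :=
      Finset.sum_le_sum fun i _ => add_le_add (hinv i t _ (hdE j)) (hinv i t _ (hdH j))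
    simp only [Finset.sum_const, Finset.card_univ, Fintype.card_fin, nsmul_eq_mul] at this
    push_cast at this
    linarith
  refine (hle.trans hsum).trans ?_
  rw [hEs, div_mul_eq_mul_div, mul_div_assoc]
  refine mul_le_mul_of_nonneg_left ?_ (by positivity)
  rw [le_div_iff₀ hm, add_mul]
  have p1 : 0 ≤ ∑ j, N (E j) t := Finset.sum_nonneg fun j _ => hN0 _ _
  have p2 : 0 ≤ ∑ j, N (H j) t := Finset.sum_nonneg fun j _ => hN0 _ _
  have q1 := mul_le_mul_of_nonneg_left (min_le_left ε μ) p1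
  have q2 := mul_le_mul_of_nonneg_left (min_le_right ε μ) p2
  linarith

end
end

section
/- Let p ∈ ℕ, let ε, μ > 0 be real constants, let t₀ ∈ ℝ, and let e_m, h_m ∈ (ℝ[x₁,x₂,x₃])³ for m = 0, …, p. Suppose E = Σ_{m=0}^p e_m(x)·(t − t₀)^m and H = Σ_{m=0}^p h_m(x)·(t − t₀)^m satisfy the polynomial Maxwell equations ε·∂ₜE = curl H and μ·∂ₜH = −curl E, and suppose e_0 = 0. Then e_m = 0 for every even m with 0 ≤ m ≤ p, and h_m = 0 for every odd m with 0 ≤ m ≤ p. (Equivalently: in the Trefftz extension of initial data (Ẽ, H̃) with Ẽ = 0, the electric field contains only odd powers of (t − t₀) and the magnetic field only even powers.) -/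
open MvPolynomial

noncomputable section

/-- The curl of a triple of polynomials in the three spatial variables `(x₁, x₂, x₃)`. -/
def curl3 (F : Fin 3 → MvPolynomial (Fin 3) ℝ) : Fin 3 → MvPolynomial (Fin 3) ℝ :=
  ![pderiv 1 (F 2) - pderiv 2 (F 1),
    pderiv 2 (F 0) - pderiv 0 (F 2),
    pderiv 0 (F 1) - pderiv 1 (F 0)]

/-- The natural inclusion of polynomials in the spatial variables `(x₁, x₂, x₃)`
into polynomials in the variables `(x₁, x₂, x₃, t)`. -/
def inclSpatial : MvPolynomial (Fin 3) ℝ →ₐ[ℝ] MvPolynomial (Fin 4) ℝ :=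
  rename Fin.castSucc

/-- Substitution `x_i ↦ x_i`, `t ↦ T + t₀`. -/
def shiftHom (t₀ : ℝ) : MvPolynomial (Fin 4) ℝ →ₐ[ℝ] Polynomial (MvPolynomial (Fin 3) ℝ) :=
  aeval ![Polynomial.C (X 0), Polynomial.C (X 1), Polynomial.C (X 2),
    Polynomial.X + Polynomial.C (C t₀)]

lemma shiftHom_incl (t₀ : ℝ) (a : MvPolynomial (Fin 3) ℝ) :
    shiftHom t₀ (inclSpatial a) = Polynomial.C a := by
  have : (shiftHom t₀).comp inclSpatial
      = (IsScalarTower.toAlgHom ℝ (MvPolynomial (Fin 3) ℝ)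
          (Polynomial (MvPolynomial (Fin 3) ℝ))) := by
    apply MvPolynomial.algHom_ext
    intro i
    fin_cases i <;> simp [shiftHom, inclSpatial, Polynomial.algebraMap_eq]
  exact DFunLike.congr_fun this a

lemma shiftHom_t (t₀ : ℝ) : shiftHom t₀ (X 3 - C t₀) = Polynomial.X := by
  have h : shiftHom t₀ (C t₀) = Polynomial.C (C t₀) := by
    rw [← MvPolynomial.algebraMap_eq, AlgHom.commutes]; rfl
  rw [map_sub, h]
  simp [shiftHom]

lemma pderiv_incl (j : Fin 3) (a : MvPolynomial (Fin 3) ℝ) :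
    pderiv j.castSucc (inclSpatial a) = inclSpatial (pderiv j a) := by
  unfold inclSpatial
  exact pderiv_rename (Fin.castSucc_injective 3) j a

lemma pderiv_three_incl (a : MvPolynomial (Fin 3) ℝ) :
    pderiv 3 (inclSpatial a) = 0 := by
  induction a using MvPolynomial.induction_on with
  | C a => simp [inclSpatial]
  | add p q hp hq => simp [hp, hq]
  | mul_X p i hp =>
    rw [map_mul, Derivation.leibniz, hp]
    have : pderiv 3 (inclSpatial (X i)) = 0 := by
      fin_cases i <;> simp [inclSpatial, pderiv_X]
    simp [this]

lemma coeff_space (p : ℕ) (t₀ : ℝ) (a : ℕ → MvPolynomial (Fin 3) ℝ) (j : Fin 3) (k : ℕ) :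
    (shiftHom t₀ (pderiv j.castSucc (∑ m ∈ Finset.range (p + 1),
      inclSpatial (a m) * (X 3 - C t₀) ^ m))).coeff k
      = if k ≤ p then pderiv j (a k) else 0 := by
  have h3 : pderiv j.castSucc (X 3 - C t₀ : MvPolynomial (Fin 4) ℝ) = 0 := by
    fin_cases j <;> simp [pderiv_X]
  have term : ∀ m, shiftHom t₀ (pderiv j.castSucc (inclSpatial (a m) * (X 3 - C t₀) ^ m))
      = Polynomial.C (pderiv j (a m)) * Polynomial.X ^ m := by
    intro m
    rw [Derivation.leibniz, Derivation.leibniz_pow, h3, pderiv_incl, smul_zero, smul_zero,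
      smul_zero, zero_add, smul_eq_mul, map_mul, map_pow, shiftHom_t, shiftHom_incl, mul_comm]
  rw [map_sum, map_sum, Finset.sum_congr rfl (fun m _ => term m), Polynomial.finsetSum_coeff]
  simp [Polynomial.coeff_C_mul, Polynomial.coeff_X_pow, Nat.lt_succ_iff]

lemma coeff_time (p : ℕ) (t₀ : ℝ) (a : ℕ → MvPolynomial (Fin 3) ℝ) (k : ℕ) (hk : k + 1 ≤ p) :
    (shiftHom t₀ (pderiv 3 (∑ m ∈ Finset.range (p + 1),
      inclSpatial (a m) * (X 3 - C t₀) ^ m))).coeff k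
      = ((k : ℝ) + 1) • a (k + 1) := by
  have h3 : pderiv 3 (X 3 - C t₀ : MvPolynomial (Fin 4) ℝ) = 1 := by simp
  have term : ∀ m, shiftHom t₀ (pderiv 3 (inclSpatial (a m) * (X 3 - C t₀) ^ m))
      = Polynomial.C (a m) * (m • Polynomial.X ^ (m - 1)) := by
    intro m
    rw [Derivation.leibniz, Derivation.leibniz_pow, h3, pderiv_three_incl, smul_zero, add_zero,
      smul_eq_mul, smul_eq_mul, mul_one, map_mul, map_nsmul, map_pow, shiftHom_t, shiftHom_incl]
  rw [map_sum, map_sum, Finset.sum_congr rfl (fun m _ => term m), Polynomial.finsetSum_coeff]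
  simp only [Polynomial.coeff_C_mul, Polynomial.coeff_smul, Polynomial.coeff_X_pow]
  rw [Finset.sum_eq_single (k + 1)]
  · simp [Algebra.smul_def, mul_comm]
  · intro m _ hm
    rcases m with _ | m
    · simp
    · have : k ≠ m := by omega
      simp [this]
  · intro hh
    simp at hh
    omega

lemma coeff_curl (p : ℕ) (t₀ : ℝ) (a : ℕ → Fin 3 → MvPolynomial (Fin 3) ℝ) (i : Fin 3) (k : ℕ)
    (hk : k ≤ p) (hz : a k = 0) :
    (shiftHom t₀ (curl4 (fun i => ∑ m ∈ Finset.range (p + 1),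
      inclSpatial (a m i) * (X 3 - C t₀) ^ m) i)).coeff k = 0 := by
  have key : ∀ j l : Fin 3, (shiftHom t₀ (pderiv j.castSucc (∑ m ∈ Finset.range (p + 1),
      inclSpatial (a m l) * (X 3 - C t₀) ^ m))).coeff k = 0 := by
    intro j l
    rw [coeff_space p t₀ (fun m => a m l) j k]
    simp [hz]
  have key' : ∀ j j' l l' : Fin 3, (shiftHom t₀ (pderiv j.castSucc (∑ m ∈ Finset.range (p + 1),
      inclSpatial (a m l) * (X 3 - C t₀) ^ m) - pderiv j'.castSucc (∑ m ∈ Finset.range (p + 1),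
      inclSpatial (a m l') * (X 3 - C t₀) ^ m))).coeff k = 0 := by
    intro j j' l l'
    rw [map_sub, Polynomial.coeff_sub, key, key, sub_zero]
  fin_cases i
  · exact key' 1 2 2 1
  · exact key' 2 0 0 2
  · exact key' 0 1 1 0

lemma step_zero (p : ℕ) (t₀ c : ℝ) (hc : c ≠ 0) (a b : ℕ → Fin 3 → MvPolynomial (Fin 3) ℝ)
    (hab : ∀ i, c • pderiv 3 (∑ m ∈ Finset.range (p + 1),
        inclSpatial (a m i) * (X 3 - C t₀) ^ m)
      = curl4 (fun i => ∑ m ∈ Finset.range (p + 1),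
        inclSpatial (b m i) * (X 3 - C t₀) ^ m) i)
    (k : ℕ) (hk : k + 1 ≤ p) (hz : b k = 0) : a (k + 1) = 0 := by
  funext i
  have h1 := congrArg (fun q => (shiftHom t₀ q).coeff k) (hab i)
  simp only [map_smul, Polynomial.coeff_smul] at h1
  rw [coeff_curl p t₀ b i k (by omega) hz, coeff_time p t₀ (fun m => a m i) k hk] at h1
  have hk0 : (k : ℝ) + 1 ≠ 0 := by positivity
  simpa [smul_eq_zero, hc, hk0] using h1

/-- If `E = Σ_{m=0}^p e_m(x)·(t-t₀)^m` and `H = Σ_{m=0}^p h_m(x)·(t-t₀)^m` satisfy the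
polynomial Maxwell equations and `e₀ = 0`, then `e_m = 0` for every even `m ≤ p` and
`h_m = 0` for every odd `m ≤ p`. -/
theorem trefftz_even_odd_vanishing (p : ℕ) (ε μ : ℝ) (hε : 0 < ε) (hμ : 0 < μ) (t₀ : ℝ)
    (e h : ℕ → Fin 3 → MvPolynomial (Fin 3) ℝ)
    (E H : Fin 3 → MvPolynomial (Fin 4) ℝ)
    (hE : E = fun i => ∑ m ∈ Finset.range (p + 1),
      inclSpatial (e m i) * (X 3 - C t₀) ^ m)
    (hH : H = fun i => ∑ m ∈ Finset.range (p + 1),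
      inclSpatial (h m i) * (X 3 - C t₀) ^ m)
    (hmaxwell1 : ∀ i, ε • pderiv 3 (E i) = curl4 H i)
    (hmaxwell2 : ∀ i, μ • pderiv 3 (H i) = - curl4 E i)
    (he0 : e 0 = 0) :
    (∀ m ≤ p, Even m → e m = 0) ∧ (∀ m ≤ p, Odd m → h m = 0) := by
  subst hE hH
  have sE : ∀ k, k + 1 ≤ p → h k = 0 → e (k + 1) = 0 :=
    step_zero p t₀ ε hε.ne' e h hmaxwell1
  have sH : ∀ k, k + 1 ≤ p → e k = 0 → h (k + 1) = 0 := by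
    refine step_zero p t₀ (-μ) (neg_ne_zero.mpr hμ.ne') h e (fun i => ?_)
    rw [neg_smul, hmaxwell2 i, neg_neg]
  have main : ∀ m ≤ p, (Even m → e m = 0) ∧ (Odd m → h m = 0) := by
    intro m
    induction m with
    | zero => intro _; exact ⟨fun _ => he0, fun hh => by simp at hh⟩
    | succ k ih =>
      intro hk
      obtain ⟨i1, i2⟩ := ih (by omega)
      refine ⟨fun hm => sE k hk (i2 ?_), fun hm => sH k hk (i1 ?_)⟩
      · by_contra hn
        rw [Nat.not_odd_iff_even] at hn
        grind
      · by_contra hn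
        rw [Nat.not_even_iff_odd] at hn
        grind
  exact ⟨fun m hm => (main m hm).1, fun m hm => (main m hm).2⟩

end
end
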